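/- Let ε∈(0,1], τ>0 and δ = min{δ₀, εα/(8(d+β+2)), ε/(dη₁²)}. For any t∈(0,τ] and x,x′∈ℝ^d satisfying Σ_{j=1}^d |x_j−x′_j|/h_j^{−1}(1/t) ≤ 1/4 and |x−x′| ≤ δ, one has |∏_{i=1}^d g_{i,t}^{(δ)}(x_i) − ∏_{i=1}^d g_{i,t}^{(δ)}(x′_i)| ≤ c·(∏_{i=1}^d tilde-g_{i,t}^{(ε)}(x_i/2))·[1 ∧ Σ_{j=1}^d |x_j−x′_j|/h_j^{−1}(1/t)] for a constant c independent of t, x, x′. -/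

import Mathlib

open Filter MeasureTheory

/-- The majorant `tilde-g_t^{(ε)}(x)`: equal to `(1/h^{-1}(1/t)) ∧ (t h(|x|)/|x|)` for
`|x| < ε` (with `h(0)/0 = ∞`) and to `c_ε t^p e^{-|x|}` for `|x| ≥ ε`, where
`p = (d+β-1)/α` and `c_ε = ((1/h^{-1}(1/τ)) ∧ (τ h(ε)/ε)) e^ε τ^{-p}`. -/
noncomputable def tg (h hinv : ℝ → ℝ) (τ ε p t x : ℝ) : ℝ :=
  if x = 0 then 1 / hinv (1 / t)
  else if |x| < ε then min (1 / hinv (1 / t)) (t * h |x| / |x|)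
  else min (1 / hinv (1 / τ)) (τ * h ε / ε) * Real.exp ε / τ ^ p *
    (t ^ p * Real.exp (-|x|))


lemma aux_int (r : ℝ) (hr : 0 < r) : Integrable (fun ξ : ℝ => (1 + (r * ξ) ^ 2)⁻¹) :=
  (integrable_inv_one_add_sq.comp_mul_left' hr.ne')

lemma aux_int_val (r : ℝ) (hr : 0 < r) : ∫ ξ : ℝ, (1 + (r * ξ) ^ 2)⁻¹ = Real.pi / r := by
  rw [Measure.integral_comp_mul_left (fun x : ℝ => (1 + x ^ 2)⁻¹) r, integral_univ_inv_one_add_sq,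
    abs_of_pos (inv_pos.2 hr), smul_eq_mul]
  field_simp

lemma aux_tendsto (r K : ℝ) (hr : 0 < r) :
    Tendsto (fun T : ℝ => K * (1 + (r * T) ^ 2)⁻¹) atTop (nhds 0) := by
  have h1 : Tendsto (fun T : ℝ => 1 + (r * T) ^ 2) atTop atTop := by
    apply tendsto_atTop_add_const_left
    exact (tendsto_pow_atTop two_ne_zero).comp (tendsto_id.const_mul_atTop hr)
  simpa using (tendsto_inv_atTop_zero.comp h1).const_mul K

lemma contour (f : ℂ → ℂ) (hf : Differentiable ℂ f) (r K l : ℝ) (hr : 0 < r)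
    (hb : ∀ ξ η : ℝ, |η| ≤ |l| → ‖f (ξ + η * Complex.I)‖ ≤ K * (1 + (r * ξ) ^ 2)⁻¹) :
    ∫ ξ : ℝ, f ξ = ∫ ξ : ℝ, f (ξ + l * Complex.I) := by
  have hc := hf.continuous
  have hint : ∀ η : ℝ, |η| ≤ |l| → Integrable (fun ξ : ℝ => f (ξ + η * Complex.I)) := by
    intro η hη
    refine Integrable.mono' ((aux_int r hr).const_mul K) ?_ (ae_of_all _ fun ξ => hb ξ η hη)
    exact (by fun_prop : Continuous fun ξ : ℝ => f (ξ + η * Complex.I)).aestronglyMeasurable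
  have i0 := hint 0 (by simp)
  simp only [Complex.ofReal_zero, zero_mul, add_zero] at i0
  have il := hint l le_rfl
  have t0 := intervalIntegral_tendsto_integral i0 tendsto_neg_atTop_atBot tendsto_id
  have tl := intervalIntegral_tendsto_integral il tendsto_neg_atTop_atBot tendsto_id
  have vb : ∀ T : ℝ, ‖∫ y : ℝ in (0:ℝ)..l, f (T + y * Complex.I)‖ ≤ K * (1 + (r * T) ^ 2)⁻¹ * |l| := by
    intro T
    have := intervalIntegral.norm_integral_le_of_norm_le_const (a := 0) (b := l)
      (f := fun y : ℝ => f (T + y * Complex.I)) (C := K * (1 + (r * T) ^ 2)⁻¹) ?_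
    · simpa using this
    · intro y hy
      apply hb
      rcases le_total 0 l with h | h
      · rw [Set.uIoc_of_le h] at hy
        rw [abs_of_pos hy.1, abs_of_nonneg h]; exact hy.2
      · rw [Set.uIoc_of_ge h] at hy
        rw [abs_of_nonpos hy.2, abs_of_nonpos h]; linarith [hy.1]
  have vt : Tendsto (fun T : ℝ => K * (1 + (r * T) ^ 2)⁻¹ * |l|) atTop (nhds 0) := by
    simpa using (aux_tendsto r K hr).mul_const |l|
  have v1 : Tendsto (fun T : ℝ => ∫ y : ℝ in (0:ℝ)..l, f (T + y * Complex.I)) atTop (nhds 0) :=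
    squeeze_zero_norm vb vt
  have v2 : Tendsto (fun T : ℝ => ∫ y : ℝ in (0:ℝ)..l, f (-T + y * Complex.I)) atTop (nhds 0) := by
    refine squeeze_zero_norm (fun T => ?_) vt
    have := vb (-T)
    simpa using this
  have C : ∀ T : ℝ, (∫ x : ℝ in -T..T, f x) - (∫ x : ℝ in -T..T, f (x + l * Complex.I))
      + Complex.I * (∫ y : ℝ in (0:ℝ)..l, f (T + y * Complex.I))
      - Complex.I * (∫ y : ℝ in (0:ℝ)..l, f (-T + y * Complex.I)) = 0 := by
    intro T
    have := Complex.integral_boundary_rect_eq_zero_of_differentiableOn f (-T) (T + l * Complex.I)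
      hf.differentiableOn
    simpa using this
  have lim := ((t0.sub tl).add (v1.const_mul Complex.I)).sub (v2.const_mul Complex.I)
  have := tendsto_nhds_unique lim (by
    refine Tendsto.congr (fun T => (C T).symm) tendsto_const_nhds)
  simp at this
  exact sub_eq_zero.1 this

lemma norm_exp_sub_one_le' (w : ℂ) (c : ℝ) (hc : 0 ≤ c) (hw : w.re ≤ c) :
    ‖Complex.exp w - 1‖ ≤ ‖w‖ * Real.exp c := by
  have hconv : Convex ℝ {z : ℂ | z.re ≤ c} := convex_halfSpace_re_le c
  have := hconv.norm_image_sub_le_of_norm_hasDerivWithin_le (f := Complex.exp) (f' := Complex.exp)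
    (C := Real.exp c) (x := 0) (y := w)
    (fun x _ => (Complex.hasDerivAt_exp x).hasDerivWithinAt) ?_ (by simpa using hc) hw
  · simpa [mul_comm] using this
  · intro x hx
    rw [Complex.norm_exp]
    exact Real.exp_le_exp.2 hx

lemma norm_sin_le' (w : ℂ) : ‖Complex.sin w‖ ≤ ‖w‖ * Real.exp ‖w‖ := by
  have h1 := norm_exp_sub_one_le' (-w * Complex.I) ‖w‖ (norm_nonneg _) (by
    simpa using (Complex.abs_im_le_norm w).trans' (le_abs_self _))
  have h2 := norm_exp_sub_one_le' (w * Complex.I) ‖w‖ (norm_nonneg _) (by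
    simpa using (Complex.abs_im_le_norm w).trans' (neg_le_abs _))
  have : Complex.sin w = ((Complex.exp (-w * Complex.I) - 1) - (Complex.exp (w * Complex.I) - 1)) * Complex.I / 2 := by
    rw [Complex.sin]; ring
  rw [this]
  simp only [norm_div, norm_mul, Complex.norm_I, mul_one, norm_neg] at *
  have h3 := norm_sub_le (Complex.exp (-w * Complex.I) - 1) (Complex.exp (w * Complex.I) - 1)
  simp only [RCLike.norm_ofNat]
  linarith

lemma norm_one_sub_cos_le' (w : ℂ) : ‖1 - Complex.cos w‖ ≤ ‖w‖ ^ 2 * Real.exp ‖w‖ := by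
  have : 1 - Complex.cos w = 2 * Complex.sin (w / 2) ^ 2 := by
    have h := Complex.cos_sq_add_sin_sq (w/2)
    have h2 : Complex.cos w = 2 * Complex.cos (w/2) ^ 2 - 1 := by
      rw [← Complex.cos_two_mul]; congr 1; ring
    rw [h2]; linear_combination (-2) * h
  rw [this]
  have h := norm_sin_le' (w / 2)
  have h2 : ‖w / 2‖ = ‖w‖ / 2 := by simp
  rw [h2] at h
  rw [norm_mul, norm_pow]
  have h3 : Real.exp ‖w‖ = Real.exp (‖w‖ / 2) ^ 2 := by
    rw [← Real.exp_nat_mul]; congr 1; push_cast; ring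
  rw [h3]
  have h4 := pow_le_pow_left₀ (norm_nonneg _) h 2
  have h5 : 0 ≤ (‖w‖ * Real.exp (‖w‖ / 2)) ^ 2 := by positivity
  simp only [RCLike.norm_ofNat]
  nlinarith

lemma cosh_sub_one_le (u : ℝ) : Real.cosh u - 1 ≤ u ^ 2 * Real.exp |u| := by
  rw [← Real.cosh_abs, ← sq_abs u]
  generalize hv : |u| = v
  have hv0 : 0 ≤ v := hv ▸ abs_nonneg u
  have h1 : Real.cosh v = (Real.exp v + Real.exp (-v)) / 2 := Real.cosh_eq v
  have h2 : 1 - v ≤ Real.exp (-v) := by linarith [Real.add_one_le_exp (-v)]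
  have h3 : Real.exp v * Real.exp (-v) = 1 := by rw [← Real.exp_add]; simp
  have h4 : Real.exp (-v) ≤ 1 := by simpa using hv0
  have h6 : (1 - Real.exp (-v)) ^ 2 ≤ v ^ 2 := by
    apply pow_le_pow_left₀ <;> linarith
  have h5 : Real.cosh v - 1 = Real.exp v * (1 - Real.exp (-v)) ^ 2 / 2 := by
    rw [h1]; linear_combination (1 - Real.exp (-v) / 2) * h3
  rw [h5]
  have := Real.exp_pos v
  nlinarith [sq_nonneg v]

section

noncomputable def PsiC (m : ℝ → ℝ) (z : ℂ) : ℂ := ∫ x : ℝ, (1 - Complex.cos (z * x)) * (m x : ℂ)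
noncomputable def psiR (m : ℝ → ℝ) (ξ : ℝ) : ℝ := ∫ x : ℝ, (1 - Real.cos (ξ * x)) * m x

lemma PsiC_int (m : ℝ → ℝ) (ρ : ℝ) (hm : Measurable m) (h0 : ∀ x, 0 ≤ m x)
    (hs : ∀ x, ρ < |x| → m x = 0) (hi : Integrable fun x => x ^ 2 * m x) (z : ℂ) :
    Integrable fun x : ℝ => (1 - Complex.cos (z * x)) * (m x : ℂ) := by
  refine Integrable.mono' (hi.const_mul (‖z‖ ^ 2 * Real.exp (‖z‖ * ρ))) ?_ (ae_of_all _ fun x => ?_)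
  · have : Continuous fun x : ℝ => (1 - Complex.cos (z * x)) := by fun_prop
    exact (this.measurable.mul (Complex.measurable_ofReal.comp hm)).aestronglyMeasurable
  · by_cases hx : ρ < |x|
    · simp [hs x hx]
    · push Not at hx
      rw [norm_mul, Complex.norm_real, Real.norm_of_nonneg (h0 x)]
      have h := norm_one_sub_cos_le' (z * x)
      rw [norm_mul, Complex.norm_real, Real.norm_eq_abs, mul_pow, sq_abs] at h
      have h2 : Real.exp (‖z‖ * |x|) ≤ Real.exp (‖z‖ * ρ) := by gcongr
      calc _ ≤ (‖z‖ ^ 2 * x ^ 2 * Real.exp (‖z‖ * |x|)) * m x := by gcongr; exact h0 x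
        _ ≤ (‖z‖ ^ 2 * x ^ 2 * Real.exp (‖z‖ * ρ)) * m x := by gcongr; exact h0 x
        _ = _ := by ring

lemma PsiC_diff (m : ℝ → ℝ) (ρ : ℝ) (hm : Measurable m) (h0 : ∀ x, 0 ≤ m x)
    (hs : ∀ x, ρ < |x| → m x = 0) (hi : Integrable fun x => x ^ 2 * m x) :
    Differentiable ℂ (PsiC m) := by
  intro z
  have hmc : Measurable fun x : ℝ => (m x : ℂ) := Complex.measurable_ofReal.comp hm
  refine (hasDerivAt_integral_of_dominated_loc_of_deriv_le
    (F := fun (z : ℂ) (x : ℝ) => (1 - Complex.cos (z * x)) * (m x : ℂ))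
    (F' := fun (z : ℂ) (x : ℝ) => (Complex.sin (z * x) * x) * (m x : ℂ))
    (bound := fun x => ((‖z‖ + 1) * Real.exp ((‖z‖ + 1) * ρ)) * (x ^ 2 * m x))
    (Metric.ball_mem_nhds z one_pos) ?_ (PsiC_int m ρ hm h0 hs hi z) ?_ ?_ (hi.const_mul _) ?_).2.differentiableAt
  · exact Eventually.of_forall fun w => (PsiC_int m ρ hm h0 hs hi w).1
  · have : Continuous fun x : ℝ => (Complex.sin (z * x) * x) := by fun_prop
    exact (this.measurable.mul hmc).aestronglyMeasurable
  · refine ae_of_all _ fun x w hw => ?_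
    have hw' : ‖w‖ ≤ ‖z‖ + 1 := by
      have := norm_sub_norm_le w z
      rw [Metric.mem_ball, dist_eq_norm] at hw; linarith
    by_cases hx : ρ < |x|
    · simp [hs x hx]
    · push Not at hx
      rw [norm_mul, Complex.norm_real, Real.norm_of_nonneg (h0 x), norm_mul, Complex.norm_real,
        Real.norm_eq_abs]
      have h := norm_sin_le' (w * x)
      rw [norm_mul, Complex.norm_real, Real.norm_eq_abs] at h
      have h2 : Real.exp (‖w‖ * |x|) ≤ Real.exp ((‖z‖ + 1) * ρ) := by gcongr
      have := h0 x
      calc _ ≤ ((‖w‖ * |x| * Real.exp (‖w‖ * |x|)) * |x|) * m x := by gcongr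
        _ ≤ (((‖z‖ + 1) * |x| * Real.exp ((‖z‖ + 1) * ρ)) * |x|) * m x := by gcongr
        _ = _ := by rw [← sq_abs x]; ring
  · refine ae_of_all _ fun x w hw => ?_
    have h1 : HasDerivAt (fun w : ℂ => w * (x : ℂ)) (x : ℂ) w := by
      simpa using (hasDerivAt_id w).mul_const (x : ℂ)
    have := ((h1.ccos).const_sub 1).mul_const (m x : ℂ)
    exact this.congr_deriv (by ring)

lemma PsiC_ofReal (m : ℝ → ℝ) (ξ : ℝ) : PsiC m ξ = psiR m ξ := by
  unfold PsiC psiR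
  rw [← integral_complex_ofReal]
  congr 1; ext x; push_cast; rfl

lemma psiR_int (m : ℝ → ℝ) (hm : Measurable m) (h0 : ∀ x, 0 ≤ m x)
    (hi : Integrable fun x => x ^ 2 * m x) (ξ : ℝ) :
    Integrable fun x : ℝ => (1 - Real.cos (ξ * x)) * m x := by
  refine Integrable.mono' (hi.const_mul (ξ ^ 2)) ?_ (ae_of_all _ fun x => ?_)
  · have : Continuous fun x : ℝ => (1 - Real.cos (ξ * x)) := by fun_prop
    exact (this.measurable.mul hm).aestronglyMeasurable
  · have h1 := Real.one_sub_sq_div_two_le_cos (x := ξ * x)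
    have h2 := Real.cos_le_one (ξ * x)
    have := h0 x
    rw [Real.norm_of_nonneg (mul_nonneg (by linarith) this)]
    have : 1 - Real.cos (ξ * x) ≤ ξ ^ 2 * x ^ 2 := by nlinarith [sq_nonneg (ξ * x)]
    calc _ ≤ ξ ^ 2 * x ^ 2 * m x := by gcongr
      _ = _ := by ring

lemma PsiC_re (m : ℝ → ℝ) (ρ : ℝ) (hm : Measurable m) (h0 : ∀ x, 0 ≤ m x)
    (hs : ∀ x, ρ < |x| → m x = 0) (hi : Integrable fun x => x ^ 2 * m x) (ξ η l : ℝ)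
    (hη : |η| ≤ l) :
    psiR m ξ - l ^ 2 * Real.exp (l * ρ) * (∫ x, x ^ 2 * m x) ≤ (PsiC m (ξ + η * Complex.I)).re := by
  have hl : 0 ≤ l := (abs_nonneg _).trans hη
  unfold PsiC psiR
  have hre := integral_re (PsiC_int m ρ hm h0 hs hi (ξ + η * Complex.I))
  simp only [RCLike.re_to_complex] at hre
  rw [← hre, ← integral_const_mul, ← integral_sub (psiR_int m hm h0 hi ξ) (hi.const_mul _)]
  refine integral_mono ((psiR_int m hm h0 hi ξ).sub (hi.const_mul _))
    (PsiC_int m ρ hm h0 hs hi (ξ + η * Complex.I)).re fun x => ?_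
  have hmx := h0 x
  simp only [Complex.re_mul_ofReal]
  by_cases hx : ρ < |x|
  · simp [hs x hx]
  push Not at hx
  have e : ((1 : ℂ) - Complex.cos ((ξ + η * Complex.I) * x)).re = 1 - Real.cos (ξ * x) * Real.cosh (η * x) := by
    have : ((ξ : ℂ) + η * Complex.I) * x = ((ξ * x : ℝ) : ℂ) + ((η * x : ℝ) : ℂ) * Complex.I := by
      push_cast; ring
    rw [this, Complex.cos_add_mul_I]
    generalize ξ * x = u
    generalize η * x = v
    rw [← Complex.ofReal_cos, ← Complex.ofReal_cosh, ← Complex.ofReal_sin, ← Complex.ofReal_sinh,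
      ← Complex.ofReal_mul, ← Complex.ofReal_mul, Complex.sub_re, Complex.sub_re,
      Complex.re_ofReal_mul, Complex.ofReal_re, Complex.I_re, Complex.one_re]
    ring
  rw [e]
  have h1 := cosh_sub_one_le (η * x)
  have h2 := Real.cos_le_one (ξ * x)
  have h3 := Real.one_le_cosh (η * x)
  have h4 : (η * x) ^ 2 ≤ l ^ 2 * x ^ 2 := by
    rw [mul_pow]; gcongr ?_ * _; exact sq_le_sq' (by linarith [neg_abs_le η]) (by linarith [le_abs_self η])
  have h5 : Real.exp |η * x| ≤ Real.exp (l * ρ) := by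
    rw [abs_mul]; gcongr
  have h6 : (η * x) ^ 2 * Real.exp |η * x| ≤ l ^ 2 * x ^ 2 * Real.exp (l * ρ) := by gcongr
  have h7 : Real.cos (ξ * x) * (Real.cosh (η * x) - 1) ≤ 1 * (Real.cosh (η * x) - 1) := by
    gcongr
  have : (1 - Real.cos (ξ * x)) - l ^ 2 * Real.exp (l * ρ) * x ^ 2 ≤ 1 - Real.cos (ξ * x) * Real.cosh (η * x) := by
    nlinarith
  calc _ = ((1 - Real.cos (ξ * x)) - l ^ 2 * Real.exp (l * ρ) * x ^ 2) * m x := by ring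
    _ ≤ _ := by gcongr

/-- Main contour-shift bound. -/
lemma shift_bound (m : ℝ → ℝ) (ρ : ℝ) (hm : Measurable m) (h0 : ∀ x, 0 ≤ m x)
    (hs : ∀ x, ρ < |x| → m x = 0) (hi : Integrable fun x => x ^ 2 * m x)
    (t r D A l : ℝ) (ht : 0 < t) (hr : 0 < r) (hl : 0 ≤ l) (hA : 0 ≤ A)
    (hD : ∀ ξ, Real.exp (-t * psiR m ξ) * ((1 + r * |ξ|) * (1 + (r * ξ) ^ 2)) ≤ D)
    (a : ℂ → ℂ) (ha : Differentiable ℂ a)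
    (hab : ∀ ξ η : ℝ, |η| ≤ l → ‖a (ξ + η * Complex.I)‖ ≤ A * (1 + r * |ξ|)) (x : ℝ) :
    ‖∫ ξ : ℝ, a ξ * Complex.exp (Complex.I * x * ξ) * (Real.exp (-t * psiR m ξ) : ℂ)‖ ≤
      A * D * (Real.pi / r) *
        Real.exp (-l * |x| + t * (l ^ 2 * Real.exp (l * ρ) * ∫ x, x ^ 2 * m x)) := by
  set S := l ^ 2 * Real.exp (l * ρ) * ∫ x, x ^ 2 * m x with hS
  set f : ℂ → ℂ := fun z => a z * Complex.exp (Complex.I * x * z) * Complex.exp (-t * PsiC m z) with hf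
  have hdf : Differentiable ℂ f := by
    have := PsiC_diff m ρ hm h0 hs hi
    fun_prop
  have base : ∀ ξ η : ℝ, |η| ≤ l → ‖f (ξ + η * Complex.I)‖ ≤
      A * D * Real.exp (-η * x + t * S) * (1 + (r * ξ) ^ 2)⁻¹ := by
    intro ξ η hη
    have h1 := hab ξ η hη
    have h2 := PsiC_re m ρ hm h0 hs hi ξ η l hη
    have h3 := hD ξ
    rw [← hS] at h2
    have e1 : ‖Complex.exp (Complex.I * x * (ξ + η * Complex.I))‖ = Real.exp (-η * x) := by
      rw [Complex.norm_exp]; congr 1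
      simp; ring
    have e2 : ‖Complex.exp (-t * PsiC m (ξ + η * Complex.I))‖ ≤ Real.exp (-t * psiR m ξ) * Real.exp (t * S) := by
      rw [Complex.norm_exp, ← Real.exp_add]
      apply Real.exp_le_exp.2
      simp
      nlinarith
    have hp : 0 < 1 + (r * ξ) ^ 2 := by positivity
    simp only [hf, norm_mul]
    rw [e1, ← div_eq_mul_inv, le_div_iff₀ hp, Real.exp_add]
    calc _ ≤ (A * (1 + r * |ξ|)) * Real.exp (-η * x) * (Real.exp (-t * psiR m ξ) * Real.exp (t * S)) * (1 + (r * ξ) ^ 2) := by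
          gcongr
      _ = A * Real.exp (-η * x) * Real.exp (t * S) * (Real.exp (-t * psiR m ξ) * ((1 + r * |ξ|) * (1 + (r * ξ) ^ 2))) := by ring
      _ ≤ A * Real.exp (-η * x) * Real.exp (t * S) * D := by gcongr
      _ = _ := by ring
  have hD0 : 0 ≤ D := le_trans (by positivity) (hD 0)
  obtain ⟨l', hl', hlx⟩ : ∃ l' : ℝ, |l'| = l ∧ l' * x = l * |x| := by
    rcases le_total 0 x with h | h
    · exact ⟨l, abs_of_nonneg hl, by rw [abs_of_nonneg h]⟩
    · exact ⟨-l, by rw [abs_neg, abs_of_nonneg hl], by rw [abs_of_nonpos h]; ring⟩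
  have hcont := contour f hdf r (A * D * Real.exp (l * |x| + t * S)) l' hr (by
    intro ξ η hη
    rw [hl'] at hη
    refine (base ξ η hη).trans ?_
    have : -η * x ≤ l * |x| := by
      calc -η * x ≤ |-η * x| := le_abs_self _
        _ = |η| * |x| := by rw [abs_mul, abs_neg]
        _ ≤ _ := by gcongr
    gcongr)
  have e : ∫ ξ : ℝ, a ξ * Complex.exp (Complex.I * x * ξ) * (Real.exp (-t * psiR m ξ) : ℂ) = ∫ ξ : ℝ, f ξ := by
    congr 1; ext ξ
    simp only [hf, PsiC_ofReal]; push_cast; rfl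
  rw [e, hcont]
  refine (norm_integral_le_of_norm_le ((aux_int r hr).const_mul (A * D * Real.exp (-l' * x + t * S)))
    (ae_of_all _ fun ξ => base ξ l' hl'.le)).trans ?_
  rw [integral_const_mul, aux_int_val r hr]
  have : -l' * x = -l * |x| := by linarith
  rw [this]
  apply le_of_eq; ring
end

lemma conv_bound (Q : ℝ → ℝ) (hQi : Integrable Q)
    (hQd : ∀ x y : ℝ, |x| / 2 ≤ |y| → Q y ≤ 8 * Q x) (hQ0 : ∀ x, 0 ≤ Q x)
    (G : ℝ → ℂ) (F : ℝ → ℝ) (a C : ℝ) (ha : 0 ≤ a)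
    (hG : ∀ x, ‖G x‖ ≤ a * Q x) (hF0 : ∀ x, 0 ≤ F x) (hF : ∀ x, F x ≤ C * Q x) (hC : 0 ≤ C) (x : ℝ) :
    ‖∫ y, G (x - y) * (F y : ℂ)‖ ≤ a * (16 * C * ∫ y, Q y) * Q x := by
  have hi : Integrable fun y => (8 * a * C * Q x) * (Q y + Q (x - y)) :=
    (hQi.add (hQi.comp_sub_left x)).const_mul _
  refine (norm_integral_le_of_norm_le hi (ae_of_all _ fun y => ?_)).trans ?_
  · rw [norm_mul, Complex.norm_real, Real.norm_of_nonneg (hF0 y)]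
    have h1 : ‖G (x - y)‖ * F y ≤ (a * Q (x - y)) * (C * Q y) := by
      gcongr
      · exact hF0 y
      · exact mul_nonneg ha (hQ0 _)
      · exact hG _
      · exact hF y
    refine h1.trans ?_
    have hy := hQ0 y
    have hxy := hQ0 (x - y)
    have hx := hQ0 x
    have haC : 0 ≤ a * C := by positivity
    rcases le_total (|x| / 2) |y| with h | h
    · have h2 := hQd x y h
      have h3 : Q (x - y) * Q y ≤ Q (x - y) * (8 * Q x) := by gcongr
      have h4 : 0 ≤ 8 * a * C * Q x * Q y := by positivity
      calc _ = a * C * (Q (x - y) * Q y) := by ring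
        _ ≤ a * C * (Q (x - y) * (8 * Q x)) := by gcongr
        _ ≤ _ := by nlinarith
    · have h5 : |x| / 2 ≤ |x - y| := by
        have := abs_sub_abs_le_abs_sub x y
        linarith
      have h2 := hQd x (x - y) h5
      have h4 : 0 ≤ 8 * a * C * Q x * Q (x - y) := by positivity
      calc _ = a * C * (Q (x - y) * Q y) := by ring
        _ ≤ a * C * ((8 * Q x) * Q y) := by gcongr
        _ ≤ _ := by nlinarith
  · rw [integral_const_mul, integral_add hQi (hQi.comp_sub_left x), integral_sub_left_eq_self]
    apply le_of_eq; ring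

noncomputable def phiF (F : ℝ → ℝ) (ξ : ℝ) : ℂ := ∫ y : ℝ, Complex.exp (-(Complex.I * y * ξ)) * (F y : ℂ)

lemma norm_exp_I (x y : ℝ) : ‖Complex.exp (Complex.I * x * y)‖ = 1 := by
  have : Complex.I * x * y = ((x * y : ℝ) : ℂ) * Complex.I := by push_cast; ring
  rw [this, Complex.norm_exp_ofReal_mul_I]

lemma norm_exp_neg_I (x y : ℝ) : ‖Complex.exp (-(Complex.I * x * y))‖ = 1 := by
  have := norm_exp_I (-x) y
  simpa using this

lemma phiF_cont (F : ℝ → ℝ) (hFi : Integrable F) : Continuous (phiF F) := by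
  unfold phiF
  refine continuous_of_dominated (bound := fun y => ‖F y‖) (fun ξ => ?_) (fun ξ => ae_of_all _ fun y => ?_)
    hFi.norm (ae_of_all _ fun y => ?_)
  · exact (by fun_prop : Continuous fun y : ℝ => Complex.exp (-(Complex.I * y * ξ))).aestronglyMeasurable.mul
      hFi.ofReal.1
  · rw [norm_mul, norm_exp_neg_I, Complex.norm_real, one_mul]
  · fun_prop

lemma phiF_norm (F : ℝ → ℝ) (hFi : Integrable F) (ξ : ℝ) : ‖phiF F ξ‖ ≤ ∫ y, ‖F y‖ := by
  refine norm_integral_le_of_norm_le hFi.norm (ae_of_all _ fun y => ?_)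
  rw [norm_mul, norm_exp_neg_I, Complex.norm_real, one_mul]

lemma phiF_even (F : ℝ → ℝ) (hFi : Integrable F) (hFe : ∀ x, F (-x) = F x) (ξ : ℝ) :
    phiF F ξ = ((∫ y, Real.cos (ξ * y) * F y : ℝ) : ℂ) := by
  have hc : Integrable fun y => Real.cos (ξ * y) * F y :=
    hFi.bdd_mul (c := 1) (by fun_prop : Continuous fun y => Real.cos (ξ * y)).aestronglyMeasurable
      (ae_of_all _ fun y => Real.abs_cos_le_one _)
  have hs : Integrable fun y => Real.sin (ξ * y) * F y :=
    hFi.bdd_mul (c := 1) (by fun_prop : Continuous fun y => Real.sin (ξ * y)).aestronglyMeasurable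
      (ae_of_all _ fun y => Real.abs_sin_le_one _)
  have hs0 : ∫ y, Real.sin (ξ * y) * F y = 0 := by
    have := integral_neg_eq_self (fun y => Real.sin (ξ * y) * F y) volume
    simp only [hFe, mul_neg, Real.sin_neg, neg_mul] at this
    rw [integral_neg] at this
    linarith
  have e : ∀ y : ℝ, Complex.exp (-(Complex.I * y * ξ)) * (F y : ℂ) =
      ((Real.cos (ξ * y) * F y : ℝ) : ℂ) - ((Real.sin (ξ * y) * F y : ℝ) : ℂ) * Complex.I := by
    intro y
    have : -(Complex.I * y * ξ) = ((-(ξ * y) : ℝ) : ℂ) * Complex.I := by push_cast; ring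
    rw [this, Complex.exp_mul_I, ← Complex.ofReal_cos, ← Complex.ofReal_sin, Real.cos_neg, Real.sin_neg]
    push_cast; ring
  unfold phiF
  simp_rw [e]
  rw [integral_sub hc.ofReal (hs.ofReal.mul_const _), integral_mul_const, integral_complex_ofReal,
    integral_complex_ofReal, hs0]
  simp

noncomputable def GG (H : ℝ → ℂ) (F : ℝ → ℝ) (n : ℕ) (x : ℝ) : ℂ :=
  ∫ ξ : ℝ, (H ξ * phiF F ξ ^ n) * Complex.exp (Complex.I * x * ξ)

lemma Hphi_int (H : ℝ → ℂ) (F : ℝ → ℝ) (hH : Integrable H) (hFi : Integrable F) (n : ℕ) :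
    Integrable fun ξ => H ξ * phiF F ξ ^ n := by
  have := hH.bdd_mul (f := fun ξ => phiF F ξ ^ n) (c := (∫ y, ‖F y‖) ^ n)
    ((phiF_cont F hFi).pow n).aestronglyMeasurable (ae_of_all _ fun ξ => by
      rw [norm_pow]; exact pow_le_pow_left₀ (norm_nonneg _) (phiF_norm F hFi ξ) n)
  simpa [mul_comm] using this

lemma GG_succ (H : ℝ → ℂ) (F : ℝ → ℝ) (hH : Integrable H) (hFi : Integrable F) (n : ℕ) (x : ℝ) :
    GG H F (n + 1) x = ∫ y, GG H F n (x - y) * (F y : ℂ) := by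
  unfold GG
  have e : ∀ y : ℝ, (∫ ξ : ℝ, (H ξ * phiF F ξ ^ n) * Complex.exp (Complex.I * ((x - y : ℝ) : ℂ) * ξ)) * (F y : ℂ)
     = ∫ ξ : ℝ, (Complex.exp (Complex.I * ((x - y : ℝ) : ℂ) * ξ)) * ((F y : ℂ) * (H ξ * phiF F ξ ^ n)) := by
    intro y
    rw [← integral_mul_const]
    congr 1; ext ξ; ring
  simp_rw [e]
  rw [integral_integral_swap]
  · congr 1; ext ξ
    have : ∀ y : ℝ, (Complex.exp (Complex.I * ((x - y : ℝ) : ℂ) * ξ)) * ((F y : ℂ) * (H ξ * phiF F ξ ^ n))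
      = (H ξ * phiF F ξ ^ n * Complex.exp (Complex.I * x * ξ)) * (Complex.exp (-(Complex.I * y * ξ)) * (F y : ℂ)) := by
      intro y
      have : Complex.I * ((x - y : ℝ) : ℂ) * ξ = Complex.I * x * ξ + -(Complex.I * y * ξ) := by
        push_cast; ring
      rw [this, Complex.exp_add]; ring
    simp_rw [this]
    rw [integral_const_mul]
    change _ = _ * phiF F ξ
    ring
  · have h1 : Integrable (fun z : ℝ × ℝ => (F z.1 : ℂ) * (H z.2 * phiF F z.2 ^ n)) (volume.prod volume) :=
      Integrable.mul_prod (f := fun y => (F y : ℂ)) hFi.ofReal (Hphi_int H F hH hFi n)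
    refine h1.bdd_mul (f := fun z : ℝ × ℝ => Complex.exp (Complex.I * ((x - z.1 : ℝ) : ℂ) * z.2)) (c := 1) ?_
      (ae_of_all _ fun z => (norm_exp_I _ _).le)
    exact (by fun_prop : Continuous fun z : ℝ × ℝ => Complex.exp (Complex.I * ((x - z.1 : ℝ) : ℂ) * z.2)).aestronglyMeasurable

lemma series_bound (H : ℝ → ℂ) (F Q : ℝ → ℝ) (hH : Integrable H) (hFi : Integrable F)
    (hQi : Integrable Q) (hQd : ∀ x y : ℝ, |x| / 2 ≤ |y| → Q y ≤ 8 * Q x) (hQ0 : ∀ x, 0 ≤ Q x)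
    (b C : ℝ) (hb : 0 ≤ b) (hC : 0 ≤ C) (hF0 : ∀ x, 0 ≤ F x) (hF : ∀ x, F x ≤ C * Q x)
    (hG : ∀ x : ℝ, ‖∫ ξ : ℝ, H ξ * Complex.exp (Complex.I * x * ξ)‖ ≤ b * Q x) (x : ℝ) :
    ‖∫ ξ : ℝ, H ξ * Complex.exp (phiF F ξ) * Complex.exp (Complex.I * x * ξ)‖ ≤
      b * Real.exp (16 * C * ∫ y, Q y) * Q x := by
  set k := 16 * C * ∫ y, Q y with hk
  have hk0 : 0 ≤ k := by
    have := integral_nonneg (μ := (volume : Measure ℝ)) (f := Q) hQ0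
    positivity
  have step : ∀ n x, ‖GG H F n x‖ ≤ (b * k ^ n) * Q x := by
    intro n
    induction n with
    | zero => intro x; simpa [GG] using hG x
    | succ n ih =>
      intro x
      rw [GG_succ H F hH hFi]
      refine (conv_bound Q hQi hQd hQ0 _ F (b * k ^ n) C (by positivity) ih hF0 hF hC x).trans ?_
      rw [← hk, pow_succ]; apply le_of_eq; ring
  set M := ∫ y, ‖F y‖ with hM
  have hs : HasSum (fun n : ℕ => ∫ ξ : ℝ, (H ξ * (phiF F ξ ^ n / n.factorial)) * Complex.exp (Complex.I * x * ξ))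
      (∫ ξ : ℝ, H ξ * Complex.exp (phiF F ξ) * Complex.exp (Complex.I * x * ξ)) := by
    have hexpR : HasSum (fun n : ℕ => M ^ n / n.factorial) (Real.exp M) := by
      rw [Real.exp_eq_exp_ℝ]; exact NormedSpace.expSeries_div_hasSum_exp M
    refine hasSum_integral_of_dominated_convergence (fun n ξ => ‖H ξ‖ * (M ^ n / n.factorial)) ?_ ?_ ?_ ?_ ?_
    · intro n
      have h1 := (phiF_cont F hFi)
      refine (hH.1.mul ?_).mul ?_
      · exact (by fun_prop : Continuous fun ξ => phiF F ξ ^ n / (n.factorial : ℂ)).aestronglyMeasurable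
      · exact (by fun_prop : Continuous fun ξ : ℝ => Complex.exp (Complex.I * x * ξ)).aestronglyMeasurable
    · intro n
      refine ae_of_all _ fun ξ => ?_
      rw [norm_mul, norm_exp_I, mul_one, norm_mul, norm_div, norm_pow, Complex.norm_natCast]
      gcongr
      exact phiF_norm F hFi ξ
    · exact ae_of_all _ fun ξ => (hexpR.mul_left _).summable
    · simp_rw [fun ξ => (hexpR.mul_left ‖H ξ‖).tsum_eq]
      exact hH.norm.mul_const _
    · refine ae_of_all _ fun ξ => ?_
      have : HasSum (fun n : ℕ => phiF F ξ ^ n / n.factorial) (Complex.exp (phiF F ξ)) := by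
        rw [Complex.exp_eq_exp_ℂ]; exact NormedSpace.expSeries_div_hasSum_exp _
      exact (this.mul_left _).mul_right _
  have hs2 : HasSum (fun n : ℕ => b * (k ^ n / n.factorial) * Q x) (b * Real.exp k * Q x) := by
    have : HasSum (fun n : ℕ => k ^ n / n.factorial) (Real.exp k) := by
      rw [Real.exp_eq_exp_ℝ]; exact NormedSpace.expSeries_div_hasSum_exp k
    exact (this.mul_left b).mul_right _
  refine hs.norm_le_of_bounded hs2 fun n => ?_
  have e : (∫ ξ : ℝ, (H ξ * (phiF F ξ ^ n / n.factorial)) * Complex.exp (Complex.I * x * ξ)) = GG H F n x / n.factorial := by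
    unfold GG
    rw [← integral_div]; congr 1; ext ξ; ring
  rw [e, norm_div, Complex.norm_natCast]
  have := step n x
  calc _ ≤ (b * k ^ n) * Q x / n.factorial := by gcongr
    _ = _ := by ring

structure HV (ν m h hinv : ℝ → ℝ) (α C₁ τ δ : ℝ) : Prop where
  hα : 0 < α
  hC₁ : 0 < C₁
  hτ : 0 < τ
  hδ : 0 < δ
  hδ1 : 2 * δ ≤ 1
  νmeas : Measurable ν
  ν0 : ∀ x, 0 ≤ ν x
  νint : Integrable (fun x : ℝ => min (x ^ 2) 1 * ν x)
  hdef : ∀ r : ℝ, 0 < r → h r = ∫ x : ℝ, min 1 (x ^ 2 / r ^ 2) * ν x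
  hcont : ContinuousOn h (Set.Ioi 0)
  hanti : StrictAntiOn h (Set.Ioi 0)
  hinvpos : ∀ s : ℝ, 0 < s → 0 < hinv s
  hinvr : ∀ s : ℝ, 0 < s → h (hinv s) = s
  hlsc : ∀ θ : ℝ, 0 < θ → ∀ l : ℝ, 1 ≤ l → C₁ * l ^ α * h (l * θ) ≤ h θ
  mmeas : Measurable m
  m0 : ∀ x, 0 ≤ m x
  mν : ∀ x, m x ≤ ν x
  meq : ∀ x, x ≠ 0 → |x| ≤ δ → m x = ν x
  mz : ∀ x, 2 * δ < |x| → m x = 0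
  meven : ∀ x, m (-x) = m x
  mle : ∀ x, x ≠ 0 → m x ≤ 8 * h |x| / |x|

namespace HV
variable {ν m h hinv : ℝ → ℝ} {α C₁ τ δ : ℝ} (V : HV ν m h hinv α C₁ τ δ)
include V

lemma h_int (r : ℝ) (hr : 0 < r) : Integrable (fun x : ℝ => min 1 (x ^ 2 / r ^ 2) * ν x) := by
  refine Integrable.mono' (V.νint.const_mul (max 1 (1 / r ^ 2))) ?_ (ae_of_all _ fun x => ?_)
  · exact ((by fun_prop : Continuous fun x : ℝ => min 1 (x ^ 2 / r ^ 2)).measurable.mul V.νmeas).aestronglyMeasurable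
  · have := V.ν0 x
    rw [Real.norm_of_nonneg (by positivity), ← mul_assoc]
    gcongr
    have h1 : (1:ℝ) ≤ max 1 (1 / r ^ 2) := le_max_left _ _
    have h2 : 1 / r ^ 2 ≤ max 1 (1 / r ^ 2) := le_max_right _ _
    rcases le_total (x ^ 2) 1 with h | h
    · rw [min_eq_left h]
      refine (min_le_right _ _).trans ?_
      calc x ^ 2 / r ^ 2 = (1 / r ^ 2) * x ^ 2 := by ring
        _ ≤ _ := by gcongr
    · rw [min_eq_right h]
      exact (min_le_left _ _).trans (by linarith)

lemma h_nonneg (r : ℝ) (hr : 0 < r) : 0 ≤ h r := by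
  rw [V.hdef r hr]
  exact integral_nonneg fun x => mul_nonneg (by positivity) (V.ν0 x)

lemma h_pos (r : ℝ) (hr : 0 < r) : 0 < h r :=
  (V.h_nonneg (r + 1) (by linarith)).trans_lt
    (V.hanti (Set.mem_Ioi.2 hr) (Set.mem_Ioi.2 (by linarith)) (by linarith))

lemma h_mono {a b : ℝ} (ha : 0 < a) (hab : a ≤ b) : h b ≤ h a :=
  V.hanti.antitoneOn (Set.mem_Ioi.2 ha) (Set.mem_Ioi.2 (ha.trans_le hab)) hab

lemma h_scale (y k : ℝ) (hy : 0 < y) (hk : 1 ≤ k) : h y ≤ k ^ 2 * h (k * y) := by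
  have hky : 0 < k * y := by positivity
  rw [V.hdef y hy, V.hdef _ hky, ← integral_const_mul]
  refine integral_mono (V.h_int y hy) ((V.h_int _ hky).const_mul _) fun x => ?_
  have := V.ν0 x
  simp only [← mul_assoc]
  gcongr
  rw [mul_min_of_nonneg _ _ (by positivity)]
  refine min_le_min ?_ ?_
  · nlinarith
  · apply le_of_eq; field_simp

lemma K_bound : ∃ L : ℝ, 0 < L ∧ ∀ s : ℝ, 0 < s →
    s ^ 2 * h s ≤ L * ∫ x in Set.Ioo (-s) s, x ^ 2 * ν x := by
  obtain ⟨Λ, hΛ1, hΛ⟩ : ∃ Λ : ℝ, 1 ≤ Λ ∧ 2 ≤ C₁ * Λ ^ α := by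
    have h1 := (tendsto_rpow_atTop V.hα).const_mul_atTop V.hC₁
    obtain ⟨Λ, h2, h3⟩ := ((h1.eventually_ge_atTop 2).and (eventually_ge_atTop 1)).exists
    exact ⟨Λ, h3, h2⟩
  refine ⟨Λ ^ 2, by positivity, fun s hs => ?_⟩
  have hsΛ : 0 < s / Λ := by positivity
  have h1 := V.hlsc (s / Λ) hsΛ Λ hΛ1
  rw [mul_div_cancel₀ _ (by positivity)] at h1
  have h2 : 2 * h s ≤ h (s / Λ) := by
    have := V.h_nonneg s hs
    nlinarith
  have hint : Integrable ((Set.Ioo (-s) s).indicator fun x => x ^ 2 * ν x) := by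
    refine Integrable.mono' ((V.h_int s hs).const_mul (s ^ 2)) ?_ (ae_of_all _ fun x => ?_)
    · exact ((by fun_prop : Continuous fun x : ℝ => x ^ 2).measurable.mul V.νmeas).aestronglyMeasurable.indicator measurableSet_Ioo
    · have hx0 := V.ν0 x
      by_cases hx : x ∈ Set.Ioo (-s) s
      · rw [Set.indicator_of_mem hx, Real.norm_of_nonneg (by positivity), ← mul_assoc]
        gcongr
        have : x ^ 2 / s ^ 2 ≤ 1 := by
          rw [div_le_one (by positivity)]; exact sq_le_sq' hx.1.le hx.2.le
        rw [min_eq_right this, mul_div_cancel₀ _ (by positivity)]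
      · rw [Set.indicator_of_notMem hx]; simp; positivity
  have h3 : h (s / Λ) ≤ h s + Λ ^ 2 / s ^ 2 * ∫ x in Set.Ioo (-s) s, x ^ 2 * ν x := by
    rw [← integral_indicator measurableSet_Ioo, V.hdef _ hsΛ, V.hdef _ hs, ← integral_const_mul,
      ← integral_add (V.h_int s hs) (hint.const_mul _)]
    refine integral_mono (V.h_int _ hsΛ) ((V.h_int s hs).add (hint.const_mul _)) fun x => ?_
    have hx0 := V.ν0 x
    by_cases hx : x ∈ Set.Ioo (-s) s
    · simp only [Set.indicator_of_mem hx]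
      have : min 1 (x ^ 2 / (s / Λ) ^ 2) ≤ Λ ^ 2 / s ^ 2 * x ^ 2 := by
        refine (min_le_right _ _).trans (le_of_eq ?_)
        field_simp
      calc _ ≤ Λ ^ 2 / s ^ 2 * x ^ 2 * ν x := by gcongr
        _ ≤ min 1 (x ^ 2 / s ^ 2) * ν x + Λ ^ 2 / s ^ 2 * x ^ 2 * ν x := by
            have : 0 ≤ min 1 (x ^ 2 / s ^ 2) * ν x := by positivity
            linarith
        _ = _ := by ring
    · simp only [Set.indicator_of_notMem hx]
      have hxs : s ^ 2 ≤ x ^ 2 := by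
        rw [← sq_abs x]
        apply pow_le_pow_left₀ hs.le
        by_contra hc
        push Not at hc
        exact hx (abs_lt.1 hc)
      have : 1 ≤ x ^ 2 / s ^ 2 := by rw [le_div_iff₀ (by positivity)]; linarith
      rw [min_eq_left this]
      have h4 : min 1 (x ^ 2 / (s / Λ) ^ 2) ≤ 1 := min_le_left _ _
      simp only [mul_zero, add_zero]
      gcongr
  have h5 : h s ≤ Λ ^ 2 / s ^ 2 * ∫ x in Set.Ioo (-s) s, x ^ 2 * ν x := by linarith
  calc s ^ 2 * h s ≤ s ^ 2 * (Λ ^ 2 / s ^ 2 * ∫ x in Set.Ioo (-s) s, x ^ 2 * ν x) := by gcongr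
    _ = _ := by field_simp

lemma x2m_int : Integrable fun x => x ^ 2 * m x := by
  refine Integrable.mono' V.νint ?_ (ae_of_all _ fun x => ?_)
  · exact ((by fun_prop : Continuous fun x : ℝ => x ^ 2).measurable.mul V.mmeas).aestronglyMeasurable
  · have h0 := V.m0 x
    have h1 := V.mν x
    have h2 := V.ν0 x
    rw [Real.norm_of_nonneg (by positivity)]
    by_cases hx : 2 * δ < |x|
    · rw [V.mz x hx]; simp; positivity
    · push Not at hx
      have : x ^ 2 ≤ 1 := by
        rw [← sq_abs]; have := V.hδ1; have := abs_nonneg x; nlinarith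
      rw [min_eq_left this]; gcongr

lemma psi_lower : ∃ c : ℝ, 0 < c ∧ ∀ ξ : ℝ, 1 / δ ≤ |ξ| → c * h (1 / |ξ|) ≤ psiR m ξ := by
  obtain ⟨L, hL, hK⟩ := V.K_bound
  refine ⟨2 / Real.pi ^ 2 / L, by positivity, fun ξ hξ => ?_⟩
  have hδ := V.hδ
  have hξ0 : 0 < |ξ| := lt_of_lt_of_le (by positivity) hξ
  set s := 1 / |ξ| with hs
  have hs0 : 0 < s := by positivity
  have hsδ : s ≤ δ := by
    rw [hs, div_le_iff₀ hξ0]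
    rw [div_le_iff₀ hδ] at hξ; linarith
  have hk := hK s hs0
  have h1 : 2 / Real.pi ^ 2 * ξ ^ 2 * ∫ x in Set.Ioo (-s) s, x ^ 2 * ν x ≤ psiR m ξ := by
    unfold psiR
    rw [← integral_indicator measurableSet_Ioo, ← integral_const_mul]
    refine integral_mono_of_nonneg (ae_of_all _ fun x => ?_) (psiR_int m V.mmeas V.m0 V.x2m_int ξ)
      (ae_of_all _ fun x => ?_)
    · have := V.ν0 x
      refine mul_nonneg (by positivity) (Set.indicator_nonneg (fun x _ => ?_) x)
      have := V.ν0 x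
      positivity
    · have hm0 := V.m0 x
      have hc := Real.cos_le_one (ξ * x)
      by_cases hx : x ∈ Set.Ioo (-s) s
      · simp only [Set.indicator_of_mem hx]
        by_cases hx0 : x = 0
        · simp [hx0]
        have hxs : |x| < s := abs_lt.2 hx
        rw [← V.meq x hx0 (hxs.le.trans hsδ)]
        have : |ξ * x| ≤ Real.pi := by
          rw [abs_mul]
          have : |ξ| * |x| ≤ |ξ| * s := by gcongr
          rw [hs, mul_one_div_cancel hξ0.ne'] at this
          linarith [Real.pi_gt_three]
        have := Real.cos_le_one_sub_mul_cos_sq this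
        calc _ = (2 / Real.pi ^ 2 * (ξ * x) ^ 2) * m x := by ring
          _ ≤ _ := by gcongr; linarith
      · simp only [Set.indicator_of_notMem hx, mul_zero]
        exact mul_nonneg (by linarith) hm0
  refine le_trans ?_ h1
  have h2 : ξ ^ 2 * s ^ 2 = 1 := by
    rw [← sq_abs ξ, hs]; field_simp
  have h3 : h s ≤ L * (ξ ^ 2 * ∫ x in Set.Ioo (-s) s, x ^ 2 * ν x) := by
    calc h s = ξ ^ 2 * (s ^ 2 * h s) := by rw [← mul_assoc, h2, one_mul]
      _ ≤ ξ ^ 2 * (L * ∫ x in Set.Ioo (-s) s, x ^ 2 * ν x) := by gcongr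
      _ = _ := by ring
  calc 2 / Real.pi ^ 2 / L * h s ≤ 2 / Real.pi ^ 2 / L * (L * (ξ ^ 2 * ∫ x in Set.Ioo (-s) s, x ^ 2 * ν x)) := by gcongr
    _ = _ := by field_simp

lemma psi_nonneg (ξ : ℝ) : 0 ≤ psiR m ξ := by
  unfold psiR
  exact integral_nonneg fun x => mul_nonneg (by linarith [Real.cos_le_one (ξ * x)]) (V.m0 x)

lemma r_pos {t : ℝ} (ht : 0 < t) : 0 < hinv (1 / t) := V.hinvpos _ (by positivity)

lemma h_r {t : ℝ} (ht : 0 < t) : h (hinv (1 / t)) = 1 / t := V.hinvr _ (by positivity)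

lemma r_mono {t : ℝ} (ht : 0 < t) (htτ : t ≤ τ) : hinv (1 / t) ≤ hinv (1 / τ) := by
  by_contra hc
  push Not at hc
  have h1 := V.hanti (Set.mem_Ioi.2 (V.r_pos V.hτ)) (Set.mem_Ioi.2 (V.r_pos ht)) hc
  rw [V.h_r ht, V.h_r V.hτ] at h1
  have : 1 / τ ≤ 1 / t := by gcongr
  linarith

lemma r_lower : ∃ B : ℝ, 0 < B ∧ ∀ t : ℝ, 0 < t → t ≤ τ → 1 / hinv (1 / t) ≤ B * (τ / t) ^ (1 / α) := by
  have hR := V.r_pos V.hτ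
  have hα := V.hα
  have hC := V.hC₁
  have hτ := V.hτ
  refine ⟨(1 / C₁) ^ (1 / α) / hinv (1 / τ), by positivity, fun t ht htτ => ?_⟩
  have hr := V.r_pos ht
  have hl : 1 ≤ hinv (1 / τ) / hinv (1 / t) := by
    rw [le_div_iff₀ hr]; linarith [V.r_mono ht htτ]
  have h1 := V.hlsc (hinv (1 / t)) hr _ hl
  rw [div_mul_cancel₀ _ hr.ne', V.h_r ht, V.h_r hτ] at h1
  have h2 : (hinv (1 / τ) / hinv (1 / t)) ^ α ≤ 1 / C₁ * (τ / t) := by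
    have : (hinv (1 / τ) / hinv (1 / t)) ^ α = (C₁ * (hinv (1 / τ) / hinv (1 / t)) ^ α * (1 / τ)) * (τ / C₁) := by
      field_simp
    rw [this]
    calc _ ≤ 1 / t * (τ / C₁) := by gcongr
      _ = _ := by ring
  have h3 : hinv (1 / τ) / hinv (1 / t) ≤ (1 / C₁ * (τ / t)) ^ (1 / α) := by
    calc _ = ((hinv (1 / τ) / hinv (1 / t)) ^ α) ^ (1 / α) := by
          rw [← Real.rpow_mul (by positivity), mul_one_div_cancel hα.ne', Real.rpow_one]
      _ ≤ _ := by gcongr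
  rw [Real.mul_rpow (by positivity) (by positivity)] at h3
  calc 1 / hinv (1 / t) = (hinv (1 / τ) / hinv (1 / t)) / hinv (1 / τ) := by field_simp
    _ ≤ ((1 / C₁) ^ (1 / α) * (τ / t) ^ (1 / α)) / hinv (1 / τ) := by gcongr
    _ = _ := by ring

lemma E_decay : ∃ D : ℝ, 0 < D ∧ ∀ t : ℝ, 0 < t → t ≤ τ → ∀ ξ : ℝ,
    Real.exp (-t * psiR m ξ) * ((1 + hinv (1 / t) * |ξ|) * (1 + (hinv (1 / t) * ξ) ^ 2)) ≤ D := by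
  obtain ⟨c, hc, hψ⟩ := V.psi_lower
  have hR := V.r_pos V.hτ
  have hα := V.hα
  have hC := V.hC₁
  have hδ := V.hδ
  set a := max 1 (hinv (1 / τ) / δ) with ha
  have ha1 : 1 ≤ a := le_max_left _ _
  obtain ⟨n, hn⟩ := exists_nat_ge (3 / α)
  have hn3 : 3 ≤ α * n := by rw [div_le_iff₀ hα] at hn; linarith
  refine ⟨(1 + a) * (1 + a ^ 2) + 4 * (n.factorial / (c * C₁) ^ n), by positivity, fun t ht htτ ξ => ?_⟩
  have hr := V.r_pos ht
  have hrR := V.r_mono ht htτ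
  have hhr := V.h_r ht
  set r := hinv (1 / t) with hrdef
  have hu2 : (r * ξ) ^ 2 = (r * |ξ|) ^ 2 := by rw [mul_pow, mul_pow, sq_abs]
  rw [hu2]
  set u := r * |ξ| with hu
  have hu0 : 0 ≤ u := by positivity
  have hnn : 0 ≤ 4 * (n.factorial / (c * C₁) ^ n) := by positivity
  rcases le_total u a with hau | hau
  · have h1 : Real.exp (-t * psiR m ξ) ≤ 1 := by
      rw [Real.exp_le_one_iff]; have := V.psi_nonneg ξ; nlinarith
    calc _ ≤ 1 * ((1 + a) * (1 + a ^ 2)) := by gcongr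
      _ ≤ _ := by linarith
  · have hu1 : 1 ≤ u := ha1.trans hau
    have hξ : 1 / δ ≤ |ξ| := by
      have h1 : hinv (1 / τ) / δ ≤ u := (le_max_right _ _).trans hau
      have h2 : r / δ ≤ r * |ξ| := le_trans (by gcongr) h1
      have : r * (1 / δ) ≤ r * |ξ| := by rw [mul_one_div]; exact h2
      exact le_of_mul_le_mul_left this hr
    have hξ0 : 0 < |ξ| := lt_of_lt_of_le (by positivity) hξ
    have h1 := hψ ξ hξ
    have h2 := V.hlsc (1 / |ξ|) (by positivity) u hu1
    have h3 : u * (1 / |ξ|) = r := by rw [hu]; field_simp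
    rw [h3, hhr] at h2
    have h4 : c * C₁ * u ^ α ≤ t * psiR m ξ := by
      calc c * C₁ * u ^ α = t * (c * (C₁ * u ^ α * (1 / t))) := by field_simp
        _ ≤ t * (c * h (1 / |ξ|)) := by gcongr
        _ ≤ _ := by gcongr
    have hw : 0 < c * C₁ * u ^ α := by positivity
    have h5 := Real.pow_div_factorial_le_exp _ hw.le n
    have h6 : u ^ 3 ≤ (u ^ α) ^ n := by
      rw [← Real.rpow_natCast (u ^ α), ← Real.rpow_mul hu0, ← Real.rpow_natCast u 3]
      exact Real.rpow_le_rpow_of_exponent_le hu1 (by exact_mod_cast hn3)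
    have h7 : Real.exp (-t * psiR m ξ) ≤ (Real.exp (c * C₁ * u ^ α))⁻¹ := by
      rw [← Real.exp_neg]; apply Real.exp_le_exp.2; linarith
    have h8 : (c * C₁) ^ n * u ^ 3 / n.factorial ≤ Real.exp (c * C₁ * u ^ α) := by
      refine le_trans ?_ h5
      rw [mul_pow (c * C₁)]; gcongr
    have h9 : (1 + u) * (1 + u ^ 2) ≤ 4 * u ^ 3 := by nlinarith [mul_nonneg hu0 (sub_nonneg.2 hu1)]
    have hexp := Real.exp_pos (c * C₁ * u ^ α)
    calc _ ≤ (Real.exp (c * C₁ * u ^ α))⁻¹ * (4 * u ^ 3) := by gcongr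
      _ ≤ 4 * (n.factorial / (c * C₁) ^ n) := by
        rw [inv_mul_le_iff₀ hexp]
        calc 4 * u ^ 3 = ((c * C₁) ^ n * u ^ 3 / n.factorial) * (4 * (n.factorial / (c * C₁) ^ n)) := by
              field_simp
          _ ≤ _ := by gcongr
      _ ≤ _ := by
        have : 0 ≤ (1 + a) * (1 + a ^ 2) := by positivity
        linarith

end HV

noncomputable def Qf (h : ℝ → ℝ) (t r x : ℝ) : ℝ := t * h (max |x| r) / max |x| r

namespace HV
variable {ν m h hinv : ℝ → ℝ} {α C₁ τ δ : ℝ} (V : HV ν m h hinv α C₁ τ δ)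
include V

lemma Q_nonneg {t r : ℝ} (ht : 0 < t) (hr : 0 < r) (x : ℝ) : 0 ≤ Qf h t r x := by
  have h1 : 0 < max |x| r := lt_max_of_lt_right hr
  have := V.h_nonneg _ h1
  unfold Qf; positivity

lemma Q_cont {t r : ℝ} (hr : 0 < r) : Continuous (Qf h t r) := by
  unfold Qf
  have h1 : Continuous fun x : ℝ => max |x| r := by fun_prop
  have h2 : Continuous fun x : ℝ => h (max |x| r) :=
    V.hcont.comp_continuous h1 fun x => lt_max_of_lt_right hr
  exact (continuous_const.mul h2).div h1 fun x => (lt_max_of_lt_right hr : 0 < max |x| r).ne'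

lemma Q_doub {t r : ℝ} (ht : 0 < t) (hr : 0 < r) (x y : ℝ) (hxy : |x| / 2 ≤ |y|) :
    Qf h t r y ≤ 8 * Qf h t r x := by
  unfold Qf
  have hx : 0 < max |x| r := lt_max_of_lt_right hr
  have hy : 0 < max |y| r := lt_max_of_lt_right hr
  set X := max |x| r
  set Y := max |y| r
  have hXY : X / 2 ≤ Y := by
    rcases le_total |x| r with h' | h'
    · have : X = r := max_eq_right h'
      have : r ≤ Y := le_max_right _ _
      linarith
    · have h1 : X = |x| := max_eq_left h'
      have : |y| ≤ Y := le_max_left _ _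
      linarith
  have h1 : h Y ≤ h (X / 2) := V.h_mono (by positivity) hXY
  have h2 := V.h_scale (X / 2) 2 (by positivity) (by norm_num)
  rw [mul_div_cancel₀ _ (two_ne_zero)] at h2
  have h3 := V.h_nonneg X hx
  calc t * h Y / Y ≤ t * (2 ^ 2 * h X) / (X / 2) := by gcongr; linarith
    _ = _ := by field_simp; ring

lemma Q_int : ∃ J : ℝ, 0 < J ∧ ∀ t : ℝ, 0 < t → Integrable (Qf h t (hinv (1 / t))) ∧
    ∫ x, Qf h t (hinv (1 / t)) x ≤ J := by
  have hα := V.hα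
  have hC := V.hC₁
  have hi : Integrable fun x : ℝ => (1 + ‖x‖) ^ (-(1 + α)) :=
    integrable_one_add_norm (by simp; exact hα)
  set J0 := ∫ x : ℝ, (1 + ‖x‖) ^ (-(1 + α)) with hJ0
  have hJ0' : 0 ≤ J0 := integral_nonneg fun x => by positivity
  refine ⟨2 ^ (1 + α) / C₁ * J0 + 1, by positivity, fun t ht => ?_⟩
  have hr := V.r_pos ht
  have hhr := V.h_r ht
  set r := hinv (1 / t)
  have hb : ∀ x, Qf h t r x ≤ 2 ^ (1 + α) / C₁ / r * (1 + ‖r⁻¹ * x‖) ^ (-(1 + α)) := by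
    intro x
    unfold Qf
    have hX : 0 < max |x| r := lt_max_of_lt_right hr
    set X := max |x| r with hXdef
    have hk : 1 ≤ X / r := by rw [le_div_iff₀ hr]; rw [one_mul]; exact le_max_right _ _
    have h1 := V.hlsc r hr (X / r) hk
    rw [div_mul_cancel₀ _ hr.ne', hhr] at h1
    have h2 : (1 + ‖r⁻¹ * x‖) / 2 ≤ X / r := by
      rw [norm_mul, norm_inv, Real.norm_of_nonneg hr.le, Real.norm_eq_abs]
      have : r⁻¹ * |x| ≤ X / r := by
        rw [inv_mul_eq_div]; gcongr; exact le_max_left _ _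
      linarith
    have hk0 : 0 < X / r := by positivity
    set k := X / r with hkdef
    have hX' : X = k * r := by rw [hkdef]; field_simp
    have hbase : 0 < (1 + ‖r⁻¹ * x‖) := by positivity
    calc t * h X / X ≤ (1 / (C₁ * k ^ α)) / X := by
          gcongr
          rw [le_div_iff₀ (by positivity)]
          calc t * h X * (C₁ * k ^ α) = t * (C₁ * k ^ α * h X) := by ring
            _ ≤ t * (1 / t) := by gcongr
            _ = 1 := by field_simp
      _ = 1 / C₁ / r * k ^ (-(1 + α)) := by
          rw [hX', Real.rpow_neg hk0.le, Real.rpow_add hk0, Real.rpow_one]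
          field_simp
      _ ≤ 1 / C₁ / r * ((1 + ‖r⁻¹ * x‖) / 2) ^ (-(1 + α)) := by
          gcongr 1 / C₁ / r * ?_
          exact Real.rpow_le_rpow_of_nonpos (by positivity) h2 (by linarith)
      _ = _ := by
          rw [Real.div_rpow hbase.le (by norm_num), Real.rpow_neg (by norm_num : (0:ℝ) ≤ 2)]
          field_simp
  have hi2 : Integrable fun x : ℝ => 2 ^ (1 + α) / C₁ / r * (1 + ‖r⁻¹ * x‖) ^ (-(1 + α)) :=
    (hi.comp_mul_left' (inv_ne_zero hr.ne')).const_mul _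
  have hQi : Integrable (Qf h t r) := by
    refine Integrable.mono' hi2 (V.Q_cont hr).aestronglyMeasurable (ae_of_all _ fun x => ?_)
    rw [Real.norm_of_nonneg (V.Q_nonneg ht hr x)]
    exact hb x
  refine ⟨hQi, ?_⟩
  refine (integral_mono hQi hi2 hb).trans ?_
  rw [integral_const_mul, Measure.integral_comp_mul_left (fun x : ℝ => (1 + ‖x‖) ^ (-(1 + α))) r⁻¹, ← hJ0,
    inv_inv, abs_of_pos hr, smul_eq_mul]
  have : 2 ^ (1 + α) / C₁ / r * (r * J0) = 2 ^ (1 + α) / C₁ * J0 := by field_simp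
  rw [this]; linarith

lemma Q_lower {t : ℝ} (ht : 0 < t) (x : ℝ) :
    Real.exp (-(1 / hinv (1 / t)) * |x|) / hinv (1 / t) ≤ 6 * Qf h t (hinv (1 / t)) x := by
  have hr := V.r_pos ht
  have hhr := V.h_r ht
  set r := hinv (1 / t)
  unfold Qf
  have hX : 0 < max |x| r := lt_max_of_lt_right hr
  set X := max |x| r with hXdef
  have hk : 1 ≤ X / r := by rw [le_div_iff₀ hr]; rw [one_mul]; exact le_max_right _ _
  have h1 := V.h_scale r (X / r) hr hk
  rw [div_mul_cancel₀ _ hr.ne', hhr] at h1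
  set k := X / r with hkdef
  have hk0 : 0 < k := by linarith
  have hX' : X = k * r := by rw [hkdef]; field_simp
  have h2 : Real.exp (-(1 / r) * |x|) * k ^ 3 ≤ 6 := by
    rcases le_total |x| r with h' | h'
    · have e : k = 1 := by rw [hkdef, hXdef, max_eq_right h']; field_simp
      rw [e]
      have : Real.exp (-(1 / r) * |x|) ≤ 1 := by
        rw [Real.exp_le_one_iff]
        have : 0 ≤ (1 / r) * |x| := by positivity
        linarith
      linarith
    · have e : -(1 / r) * |x| = -k := by rw [hkdef, hXdef, max_eq_left h']; ring
      rw [e, Real.exp_neg, inv_mul_le_iff₀ (Real.exp_pos _)]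
      have := Real.pow_div_factorial_le_exp k hk0.le 3
      rw [div_le_iff₀ (by positivity)] at this
      simpa [Nat.factorial] using this
  have h3 : 1 / k ^ 2 ≤ t * h X := by
    rw [div_le_iff₀ (by positivity)]
    calc (1:ℝ) = t * (1 / t) := by field_simp
      _ ≤ t * (k ^ 2 * h X) := by gcongr
      _ = _ := by ring
  calc _ ≤ (6 / k ^ 3) / r := by
        gcongr
        rw [le_div_iff₀ (by positivity)]; exact h2
    _ = 6 * ((1 / k ^ 2) / X) := by rw [hX']; field_simp
    _ ≤ _ := by gcongr

lemma near : ∃ K : ℝ, 0 < K ∧ ∀ t : ℝ, 0 < t → t ≤ τ → ∀ (a : ℂ → ℂ) (A : ℝ), Differentiable ℂ a →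
    0 ≤ A → (∀ ξ η : ℝ, |η| ≤ 1 / hinv (1 / t) → ‖a (ξ + η * Complex.I)‖ ≤ A * (1 + hinv (1 / t) * |ξ|)) →
    ∀ x : ℝ, ‖∫ ξ : ℝ, a ξ * Complex.exp (Complex.I * x * ξ) * (Real.exp (-t * psiR m ξ) : ℂ)‖ ≤
      A * K * Qf h t (hinv (1 / t)) x := by
  obtain ⟨D, hD, hE⟩ := V.E_decay
  obtain ⟨J, hJ, hQ⟩ := V.Q_int
  refine ⟨6 * (Real.exp 2 * D * Real.pi * Real.exp (Real.exp 1)) * Real.exp (16 * 8 * J), by positivity, ?_⟩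
  intro t ht htτ a A ha hA hab x
  obtain ⟨hQi, hQJ⟩ := hQ t ht
  have hr := V.r_pos ht
  have hhr := V.h_r ht
  have hE := hE t ht htτ
  have hQl := V.Q_lower ht
  set r := hinv (1 / t)
  set m1 : ℝ → ℝ := fun x => if |x| ≤ r then m x else 0 with hm1
  set F : ℝ → ℝ := fun x => if |x| ≤ r then 0 else t * m x with hF
  have hset : MeasurableSet {x : ℝ | |x| ≤ r} := measurableSet_le (by fun_prop) (by fun_prop)
  have m1meas : Measurable m1 := Measurable.ite hset V.mmeas measurable_const
  have Fmeas : Measurable F := Measurable.ite hset measurable_const (V.mmeas.const_mul t)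
  have m10 : ∀ x, 0 ≤ m1 x := fun x => by
    simp only [hm1]; split_ifs; exacts [V.m0 x, le_rfl]
  have F0 : ∀ x, 0 ≤ F x := fun x => by
    have := V.m0 x
    simp only [hF]; split_ifs
    · exact le_rfl
    · positivity
  have m1s : ∀ x, r < |x| → m1 x = 0 := fun x hx => by
    simp only [hm1]; rw [if_neg (not_le.2 hx)]
  have m1i : Integrable fun x => x ^ 2 * m1 x := by
    refine Integrable.mono' V.x2m_int ?_ (ae_of_all _ fun x => ?_)
    · exact ((by fun_prop : Continuous fun x : ℝ => x ^ 2).measurable.mul m1meas).aestronglyMeasurable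
    · have h1 := m10 x
      rw [Real.norm_of_nonneg (by positivity)]
      gcongr
      simp only [hm1]; split_ifs; exacts [le_rfl, V.m0 x]
  have Fb : ∀ x, F x ≤ t * (min 1 (x ^ 2 / r ^ 2) * ν x) := fun x => by
    have h1 := V.ν0 x
    have h2 := V.mν x
    simp only [hF]; split_ifs with hx
    · positivity
    · push Not at hx
      have : 1 ≤ x ^ 2 / r ^ 2 := by
        rw [le_div_iff₀ (by positivity), one_mul, ← sq_abs x]; gcongr
      rw [min_eq_left this, one_mul]; gcongr
  have Fi : Integrable F := by
    refine Integrable.mono' ((V.h_int r hr).const_mul t) Fmeas.aestronglyMeasurable (ae_of_all _ fun x => ?_)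
    rw [Real.norm_of_nonneg (F0 x)]; exact Fb x
  have FM : ∫ x, F x ≤ 1 := by
    refine (integral_mono Fi ((V.h_int r hr).const_mul t) Fb).trans ?_
    rw [integral_const_mul, ← V.hdef r hr, hhr]; apply le_of_eq; field_simp
  have FM0 : 0 ≤ ∫ x, F x := integral_nonneg F0
  have FQ : ∀ x, F x ≤ 8 * Qf h t r x := fun x => by
    have h0 := V.Q_nonneg ht hr x
    simp only [hF]; split_ifs with hx
    · positivity
    · push Not at hx
      have hx0 : x ≠ 0 := by rintro rfl; simp at hx; linarith
      have := V.mle x hx0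
      unfold Qf
      rw [max_eq_left hx.le]
      calc t * m x ≤ t * (8 * h |x| / |x|) := by gcongr
        _ = _ := by ring
  have Fe : ∀ x, F (-x) = F x := fun x => by simp only [hF, abs_neg, V.meven]
  have m1S : ∫ x, x ^ 2 * m1 x ≤ r ^ 2 / t := by
    have : r ^ 2 / t = ∫ x, r ^ 2 * (min 1 (x ^ 2 / r ^ 2) * ν x) := by
      rw [integral_const_mul, ← V.hdef r hr, hhr]; ring
    rw [this]
    refine integral_mono m1i ((V.h_int r hr).const_mul _) fun x => ?_
    have h1 := V.ν0 x
    have h2 := V.mν x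
    simp only [hm1]; split_ifs with hx
    · have : x ^ 2 / r ^ 2 ≤ 1 := by
        rw [div_le_one (by positivity), ← sq_abs x]; gcongr
      rw [min_eq_right this]
      calc x ^ 2 * m x ≤ x ^ 2 * ν x := by gcongr
        _ = _ := by field_simp
    · simp only [mul_zero]; positivity
  have cosFi : ∀ ξ : ℝ, Integrable fun y => Real.cos (ξ * y) * F y := fun ξ =>
    Fi.bdd_mul (c := 1) (by fun_prop : Continuous fun y => Real.cos (ξ * y)).aestronglyMeasurable
      (ae_of_all _ fun y => Real.abs_cos_le_one _)
  have split : ∀ ξ, t * psiR m ξ = t * psiR m1 ξ + (∫ x, F x) - ∫ y, Real.cos (ξ * y) * F y := by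
    intro ξ
    unfold psiR
    have hadd : Integrable (fun x => t * ((1 - Real.cos (ξ * x)) * m1 x) + F x) :=
      ((psiR_int m1 m1meas m10 m1i ξ).const_mul t).add Fi
    rw [← integral_const_mul, ← integral_const_mul, ← integral_add ((psiR_int m1 m1meas m10 m1i ξ).const_mul t) Fi,
      ← integral_sub hadd (cosFi ξ)]
    congr 1; ext x
    simp only [hm1, hF]; split_ifs <;> ring
  have cosle : ∀ ξ, |∫ y, Real.cos (ξ * y) * F y| ≤ 1 := by
    intro ξ
    rw [← Real.norm_eq_abs]
    refine le_trans (norm_integral_le_of_norm_le Fi (ae_of_all _ fun y => ?_)) FM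
    rw [norm_mul, Real.norm_of_nonneg (F0 y)]
    have := Real.abs_cos_le_one (ξ * y)
    rw [Real.norm_eq_abs]
    nlinarith [F0 y]
  have hD1 : ∀ ξ, Real.exp (-t * psiR m1 ξ) * ((1 + r * |ξ|) * (1 + (r * ξ) ^ 2)) ≤ Real.exp 2 * D := by
    intro ξ
    have h1 : Real.exp (-t * psiR m1 ξ) ≤ Real.exp 2 * Real.exp (-t * psiR m ξ) := by
      rw [← Real.exp_add]; apply Real.exp_le_exp.2
      have := split ξ
      have := abs_le.1 (cosle ξ)
      linarith
    calc _ ≤ Real.exp 2 * Real.exp (-t * psiR m ξ) * ((1 + r * |ξ|) * (1 + (r * ξ) ^ 2)) := by gcongr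
      _ = Real.exp 2 * (Real.exp (-t * psiR m ξ) * ((1 + r * |ξ|) * (1 + (r * ξ) ^ 2))) := by ring
      _ ≤ _ := by gcongr; exact hE ξ
  set H : ℝ → ℂ := fun ξ => a ξ * (Real.exp (-t * psiR m1 ξ) : ℂ) with hH
  have Hi : Integrable H := by
    refine Integrable.mono' ((aux_int r hr).const_mul (A * (Real.exp 2 * D))) ?_ (ae_of_all _ fun ξ => ?_)
    · have h1 := ha.continuous
      have h2 := (PsiC_diff m1 r m1meas m10 m1s m1i).continuous
      have : H = fun ξ : ℝ => a ξ * Complex.exp (-t * PsiC m1 ξ) := by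
        ext ξ; simp only [hH, PsiC_ofReal]; push_cast; rfl
      rw [this]
      exact (by fun_prop : Continuous fun ξ : ℝ => a ξ * Complex.exp (-t * PsiC m1 ξ)).aestronglyMeasurable
    · have h1 := hab ξ 0 (by simp; exact hr.le)
      simp only [Complex.ofReal_zero, zero_mul, add_zero] at h1
      simp only [hH]
      rw [norm_mul, Complex.norm_real, Real.norm_of_nonneg (Real.exp_pos _).le, ← div_eq_mul_inv,
        le_div_iff₀ (by positivity)]
      calc _ ≤ (A * (1 + r * |ξ|)) * Real.exp (-t * psiR m1 ξ) * (1 + (r * ξ) ^ 2) := by gcongr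
        _ = A * (Real.exp (-t * psiR m1 ξ) * ((1 + r * |ξ|) * (1 + (r * ξ) ^ 2))) := by ring
        _ ≤ A * (Real.exp 2 * D) := mul_le_mul_of_nonneg_left (hD1 ξ) hA
  set b := 6 * (A * (Real.exp 2 * D) * Real.pi * Real.exp (Real.exp 1)) with hb
  have hG : ∀ x : ℝ, ‖∫ ξ : ℝ, H ξ * Complex.exp (Complex.I * x * ξ)‖ ≤ b * Qf h t r x := by
    intro x
    have h1 := shift_bound m1 r m1meas m10 m1s m1i t r (Real.exp 2 * D) A (1 / r) ht hr (by positivity) hA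
      hD1 a ha hab x
    have e : ∫ ξ : ℝ, H ξ * Complex.exp (Complex.I * x * ξ) =
        ∫ ξ : ℝ, a ξ * Complex.exp (Complex.I * x * ξ) * (Real.exp (-t * psiR m1 ξ) : ℂ) := by
      congr 1; ext ξ; simp only [hH]; ring
    rw [e]
    refine h1.trans ?_
    have h2 : t * ((1 / r) ^ 2 * Real.exp (1 / r * r) * ∫ x, x ^ 2 * m1 x) ≤ Real.exp 1 := by
      calc _ ≤ t * ((1 / r) ^ 2 * Real.exp (1 / r * r) * (r ^ 2 / t)) := by gcongr
        _ = _ := by rw [one_div_mul_cancel hr.ne']; field_simp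
    calc _ ≤ A * (Real.exp 2 * D) * (Real.pi / r) * Real.exp (-(1 / r) * |x| + Real.exp 1) := by gcongr
      _ = (A * (Real.exp 2 * D) * Real.pi * Real.exp (Real.exp 1)) * (Real.exp (-(1 / r) * |x|) / r) := by
          rw [Real.exp_add]; ring
      _ ≤ (A * (Real.exp 2 * D) * Real.pi * Real.exp (Real.exp 1)) * (6 * Qf h t r x) := by
          gcongr; exact hQl x
      _ = _ := by rw [hb]; ring
  have main := series_bound H F (Qf h t r) Hi Fi hQi (V.Q_doub ht hr) (V.Q_nonneg ht hr) b 8 (by positivity)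
    (by norm_num) F0 FQ hG x
  have e : ∫ ξ : ℝ, a ξ * Complex.exp (Complex.I * x * ξ) * (Real.exp (-t * psiR m ξ) : ℂ) =
      (Real.exp (-∫ x, F x) : ℂ) * ∫ ξ : ℝ, H ξ * Complex.exp (phiF F ξ) * Complex.exp (Complex.I * x * ξ) := by
    rw [← integral_const_mul]
    congr 1; ext ξ
    rw [phiF_even F Fi Fe, ← Complex.ofReal_exp]
    simp only [hH]
    have : Real.exp (-t * psiR m ξ) = Real.exp (-∫ x, F x) * Real.exp (-t * psiR m1 ξ) *
        Real.exp (∫ y, Real.cos (ξ * y) * F y) := by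
      rw [← Real.exp_add, ← Real.exp_add]; congr 1; linarith [split ξ]
    rw [this]; push_cast; ring
  rw [e, norm_mul, Complex.norm_real, Real.norm_of_nonneg (Real.exp_pos _).le]
  have hQ0 := V.Q_nonneg ht hr x
  calc _ ≤ 1 * (b * Real.exp (16 * 8 * ∫ y, Qf h t r y) * Qf h t r x) := by
        gcongr
        rw [Real.exp_le_one_iff]; linarith
    _ ≤ 1 * (b * Real.exp (16 * 8 * J) * Qf h t r x) := by gcongr
    _ = _ := by rw [hb]; ring

lemma far : ∃ K : ℝ, 0 < K ∧ ∀ t : ℝ, 0 < t → t ≤ τ → ∀ (a : ℂ → ℂ) (A : ℝ), Differentiable ℂ a →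
    0 ≤ A → (∀ ξ η : ℝ, |η| ≤ 1 / (4 * δ) * Real.log (Real.exp 1 * τ / t) →
      ‖a (ξ + η * Complex.I)‖ ≤ A * (1 + hinv (1 / t) * |ξ|)) →
    ∀ x : ℝ, ‖∫ ξ : ℝ, a ξ * Complex.exp (Complex.I * x * ξ) * (Real.exp (-t * psiR m ξ) : ℂ)‖ ≤
      A * K / hinv (1 / t) * (t / (Real.exp 1 * τ)) ^ (|x| / (4 * δ)) := by
  obtain ⟨D, hD, hE⟩ := V.E_decay
  have hδ := V.hδ
  have hτ := V.hτ
  set S := ∫ x, x ^ 2 * m x with hS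
  have hS0 : 0 ≤ S := integral_nonneg fun x => mul_nonneg (sq_nonneg _) (V.m0 x)
  refine ⟨D * Real.pi * Real.exp (Real.exp 1 * τ / (2 * δ ^ 2) * S), by positivity, ?_⟩
  intro t ht htτ a A ha hA hab x
  have hr := V.r_pos ht
  have hE := hE t ht htτ
  set r := hinv (1 / t)
  set l := 1 / (4 * δ) * Real.log (Real.exp 1 * τ / t) with hl
  have hq : 0 < Real.exp 1 * τ / t := by positivity
  have hq1 : 1 ≤ Real.exp 1 * τ / t := by
    rw [le_div_iff₀ ht]
    have : 1 ≤ Real.exp 1 := Real.one_le_exp (by norm_num)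
    nlinarith
  have hl0 : 0 ≤ l := by
    have := Real.log_nonneg hq1
    positivity
  have h1 := shift_bound m (2 * δ) V.mmeas V.m0 V.mz V.x2m_int t r D A l ht hr hl0 hA hE a ha hab x
  rw [← hS] at h1
  refine h1.trans ?_
  have h2 : t * (l ^ 2 * Real.exp (l * (2 * δ)) * S) ≤ Real.exp 1 * τ / (2 * δ ^ 2) * S := by
    have h3 := Real.pow_div_factorial_le_exp (l * (2 * δ)) (by positivity) 2
    have h4 : l ^ 2 ≤ Real.exp (l * (2 * δ)) / (2 * δ ^ 2) := by
      rw [le_div_iff₀ (by positivity)]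
      simp [Nat.factorial] at h3
      nlinarith
    have h5 : Real.exp (l * (2 * δ)) * Real.exp (l * (2 * δ)) = Real.exp 1 * τ / t := by
      rw [← Real.exp_add]
      have : l * (2 * δ) + l * (2 * δ) = Real.log (Real.exp 1 * τ / t) := by rw [hl]; field_simp; ring
      rw [this, Real.exp_log hq]
    calc _ ≤ t * (Real.exp (l * (2 * δ)) / (2 * δ ^ 2) * Real.exp (l * (2 * δ)) * S) := by gcongr
      _ = t * (Real.exp (l * (2 * δ)) * Real.exp (l * (2 * δ))) / (2 * δ ^ 2) * S := by ring
      _ = _ := by rw [h5]; field_simp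
  have h6 : Real.exp (-l * |x|) = (t / (Real.exp 1 * τ)) ^ (|x| / (4 * δ)) := by
    rw [Real.rpow_def_of_pos (by positivity)]
    congr 1
    have : t / (Real.exp 1 * τ) = (Real.exp 1 * τ / t)⁻¹ := by rw [inv_div]
    rw [this, Real.log_inv, hl]; ring
  calc _ ≤ A * D * (Real.pi / r) * Real.exp (-l * |x| + Real.exp 1 * τ / (2 * δ ^ 2) * S) := by gcongr
    _ = _ := by rw [Real.exp_add, h6]; ring

end HV

noncomputable def Gk (m : ℝ → ℝ) (t x : ℝ) : ℝ :=
  (2 * Real.pi)⁻¹ * ∫ ξ : ℝ, Real.cos (x * ξ) * Real.exp (-t * psiR m ξ)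

lemma mult_bound (s ξ η l : ℝ) (hη : |η| ≤ l) :
    ‖(1 : ℂ) - Complex.exp (Complex.I * s * (ξ + η * Complex.I))‖ ≤ |s| * (|ξ| + l) * Real.exp (|s| * l) := by
  have hl : 0 ≤ l := (abs_nonneg _).trans hη
  rw [norm_sub_rev]
  have hre : (Complex.I * s * (ξ + η * Complex.I)).re = -(s * η) := by
    simp [Complex.mul_re, Complex.mul_im]
  have h1 : (Complex.I * s * (ξ + η * Complex.I)).re ≤ |s| * l := by
    rw [hre]
    calc -(s * η) ≤ |s * η| := neg_le_abs _
      _ = |s| * |η| := abs_mul _ _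
      _ ≤ _ := by gcongr
  refine (norm_exp_sub_one_le' _ (|s| * l) (by positivity) h1).trans ?_
  gcongr
  rw [norm_mul, norm_mul, Complex.norm_I, one_mul, Complex.norm_real, Real.norm_eq_abs]
  gcongr
  refine (norm_add_le _ _).trans ?_
  rw [norm_mul, Complex.norm_I, mul_one, Complex.norm_real, Complex.norm_real, Real.norm_eq_abs, Real.norm_eq_abs]
  gcongr

namespace HV

lemma E_int {ν m h hinv : ℝ → ℝ} {α C₁ τ δ : ℝ} (V : HV ν m h hinv α C₁ τ δ) {t : ℝ} (ht : 0 < t) (htτ : t ≤ τ) :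
    Integrable fun ξ : ℝ => (Real.exp (-t * psiR m ξ) : ℂ) := by
  obtain ⟨D, hD, hE⟩ := V.E_decay
  have hr := V.r_pos ht
  refine Integrable.mono' ((aux_int _ hr).const_mul D) ?_ (ae_of_all _ fun ξ => ?_)
  · have h2 := (PsiC_diff m (2 * δ) V.mmeas V.m0 V.mz V.x2m_int).continuous
    have : (fun ξ : ℝ => (Real.exp (-t * psiR m ξ) : ℂ)) = fun ξ : ℝ => Complex.exp (-t * PsiC m ξ) := by
      ext ξ; simp only [PsiC_ofReal]; push_cast; rfl
    rw [this]
    exact (by fun_prop : Continuous fun ξ : ℝ => Complex.exp (-t * PsiC m ξ)).aestronglyMeasurable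
  · rw [Complex.norm_real, Real.norm_of_nonneg (Real.exp_pos _).le, ← div_eq_mul_inv,
        le_div_iff₀ (by positivity)]
    refine le_trans ?_ (hE t ht htτ ξ)
    gcongr
    have : 0 ≤ hinv (1 / t) * |ξ| := by positivity
    nlinarith [sq_nonneg (hinv (1 / t) * ξ)]

lemma eE_int {ν m h hinv : ℝ → ℝ} {α C₁ τ δ : ℝ} (V : HV ν m h hinv α C₁ τ δ) {t : ℝ} (ht : 0 < t) (htτ : t ≤ τ) (x : ℝ) :
    Integrable fun ξ : ℝ => Complex.exp (Complex.I * x * ξ) * (Real.exp (-t * psiR m ξ) : ℂ) :=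
  (V.E_int ht htτ).bdd_mul (c := 1)
    (by fun_prop : Continuous fun ξ : ℝ => Complex.exp (Complex.I * x * ξ)).aestronglyMeasurable
    (ae_of_all _ fun y => (norm_exp_I x y).le)

lemma G_re {ν m h hinv : ℝ → ℝ} {α C₁ τ δ : ℝ} (V : HV ν m h hinv α C₁ τ δ) {t : ℝ} (ht : 0 < t) (htτ : t ≤ τ) (x : ℝ) :
    Gk m t x = (2 * Real.pi)⁻¹ *
      (∫ ξ : ℝ, Complex.exp (Complex.I * x * ξ) * (Real.exp (-t * psiR m ξ) : ℂ)).re := by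
  unfold Gk
  have := integral_re (V.eE_int ht htτ x)
  simp only [RCLike.re_eq_complex_re] at this
  rw [← this]
  congr 2; ext ξ
  rw [Complex.re_mul_ofReal, Complex.exp_re]
  simp [Complex.mul_re, Complex.mul_im]

lemma G_le {ν m h hinv : ℝ → ℝ} {α C₁ τ δ : ℝ} (V : HV ν m h hinv α C₁ τ δ) {t : ℝ} (ht : 0 < t) (htτ : t ≤ τ) (x : ℝ) :
    |Gk m t x| ≤ ‖∫ ξ : ℝ, (fun _ : ℂ => (1 : ℂ)) ξ * Complex.exp (Complex.I * x * ξ) * (Real.exp (-t * psiR m ξ) : ℂ)‖ := by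
  rw [V.G_re ht htτ]
  simp only [one_mul]
  have hp := Real.pi_gt_three
  rw [abs_mul, abs_of_pos (by positivity)]
  have : (2 * Real.pi)⁻¹ ≤ 1 := inv_le_one_of_one_le₀ (by linarith)
  calc _ ≤ 1 * _ := mul_le_mul this (Complex.abs_re_le_norm _) (abs_nonneg _) zero_le_one
    _ = _ := one_mul _

lemma Gd_le {ν m h hinv : ℝ → ℝ} {α C₁ τ δ : ℝ} (V : HV ν m h hinv α C₁ τ δ) {t : ℝ} (ht : 0 < t) (htτ : t ≤ τ) (x s : ℝ) :
    |Gk m t x - Gk m t (x + s)| ≤ ‖∫ ξ : ℝ, (fun z : ℂ => (1 : ℂ) - Complex.exp (Complex.I * s * z)) ξ *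
      Complex.exp (Complex.I * x * ξ) * (Real.exp (-t * psiR m ξ) : ℂ)‖ := by
  have e : ∫ ξ : ℝ, (fun z : ℂ => (1 : ℂ) - Complex.exp (Complex.I * s * z)) ξ *
      Complex.exp (Complex.I * x * ξ) * (Real.exp (-t * psiR m ξ) : ℂ) =
      (∫ ξ : ℝ, Complex.exp (Complex.I * x * ξ) * (Real.exp (-t * psiR m ξ) : ℂ)) -
      (∫ ξ : ℝ, Complex.exp (Complex.I * (x + s : ℝ) * ξ) * (Real.exp (-t * psiR m ξ) : ℂ)) := by
    rw [← integral_sub (V.eE_int ht htτ x) (V.eE_int ht htτ (x + s))]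
    congr 1; ext ξ
    have : Complex.exp (Complex.I * (x + s : ℝ) * ξ) =
        Complex.exp (Complex.I * s * ξ) * Complex.exp (Complex.I * x * ξ) := by
      rw [← Complex.exp_add]; congr 1; push_cast; ring
    rw [this]; ring
  rw [e, V.G_re ht htτ, V.G_re ht htτ, ← mul_sub, ← Complex.sub_re]
  have hp := Real.pi_gt_three
  rw [abs_mul, abs_of_pos (by positivity)]
  have : (2 * Real.pi)⁻¹ ≤ 1 := inv_le_one_of_one_le₀ (by linarith)
  calc _ ≤ 1 * _ := mul_le_mul this (Complex.abs_re_le_norm _) (abs_nonneg _) zero_le_one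
    _ = _ := one_mul _

lemma nearQ {ν m h hinv : ℝ → ℝ} {α C₁ τ δ : ℝ} (V : HV ν m h hinv α C₁ τ δ) :
    ∃ K : ℝ, 0 < K ∧ ∀ t : ℝ, 0 < t → t ≤ τ → ∀ x s : ℝ, |s| ≤ hinv (1 / t) / 4 →
      |Gk m t x| ≤ K * Qf h t (hinv (1 / t)) x ∧
      |Gk m t x - Gk m t (x + s)| ≤ K * Qf h t (hinv (1 / t)) x * (|s| / hinv (1 / t)) := by
  obtain ⟨K, hK, H⟩ := V.near
  refine ⟨K * Real.exp 1, by positivity, fun t ht htτ x s hs => ?_⟩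
  have hr := V.r_pos ht
  have hQ := V.Q_nonneg ht hr x
  set r := hinv (1 / t)
  have he : 1 ≤ Real.exp 1 := Real.one_le_exp (by norm_num)
  constructor
  · refine (V.G_le ht htτ x).trans ((H t ht htτ (fun _ : ℂ => (1 : ℂ)) 1 (by fun_prop) zero_le_one ?_ x).trans ?_)
    · intro ξ η _
      have : 0 ≤ r * |ξ| := by positivity
      simp only [norm_one]; linarith
    · rw [one_mul]
      exact mul_le_mul_of_nonneg_right (le_mul_of_one_le_right hK.le he) hQ
  · refine (V.Gd_le ht htτ x s).trans ((H t ht htτ (fun z : ℂ => (1 : ℂ) - Complex.exp (Complex.I * s * z)) (|s| / r * Real.exp 1) (by fun_prop) (by positivity) ?_ x).trans ?_)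
    · intro ξ η hη
      refine (mult_bound s ξ η _ hη).trans ?_
      have : |s| * (1 / r) ≤ 1 := by
        rw [mul_one_div, div_le_one hr]; linarith
      calc _ ≤ |s| * (|ξ| + 1 / r) * Real.exp 1 := by gcongr
        _ = _ := by field_simp; ring
    · apply le_of_eq; ring

lemma farQ {ν m h hinv : ℝ → ℝ} {α C₁ τ δ : ℝ} (V : HV ν m h hinv α C₁ τ δ) :
    ∃ K : ℝ, 0 < K ∧ ∀ t : ℝ, 0 < t → t ≤ τ → ∀ x s : ℝ, |s| ≤ δ →
      |Gk m t x| ≤ K / hinv (1 / t) * ((Real.exp 1 * τ / t) * (t / (Real.exp 1 * τ)) ^ (|x| / (4 * δ))) ∧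
      |Gk m t x - Gk m t (x + s)| ≤ K / hinv (1 / t) *
        ((Real.exp 1 * τ / t) * (t / (Real.exp 1 * τ)) ^ (|x| / (4 * δ))) * (|s| / hinv (1 / t)) := by
  obtain ⟨K, hK, H⟩ := V.far
  have hδ := V.hδ
  have hτ := V.hτ
  have hR := V.r_pos hτ
  set R := hinv (1 / τ) with hRd
  refine ⟨K * (1 + R / δ), by positivity, fun t ht htτ x s hs => ?_⟩
  have hr := V.r_pos ht
  have hrR : hinv (1 / t) ≤ R := V.r_mono ht htτ
  set r := hinv (1 / t)
  have he : 1 ≤ Real.exp 1 := Real.one_le_exp (by norm_num)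
  have hq : 1 ≤ Real.exp 1 * τ / t := by
    rw [le_div_iff₀ ht]; nlinarith
  have hRd1 : 1 ≤ 1 + R / δ := by
    have : 0 ≤ R / δ := by positivity
    linarith
  have hq0 : 0 ≤ (t / (Real.exp 1 * τ)) ^ (|x| / (4 * δ)) := by positivity
  set q := (t / (Real.exp 1 * τ)) ^ (|x| / (4 * δ))
  constructor
  · refine (V.G_le ht htτ x).trans ((H t ht htτ (fun _ : ℂ => (1 : ℂ)) 1 (by fun_prop) zero_le_one ?_ x).trans ?_)
    · intro ξ η _
      have : 0 ≤ r * |ξ| := by positivity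
      simp only [norm_one]; linarith
    · rw [one_mul]
      gcongr ?_ / r * ?_
      · exact le_mul_of_one_le_right hK.le hRd1
      · exact le_mul_of_one_le_left hq0 hq
  · refine (V.Gd_le ht htτ x s).trans ((H t ht htτ (fun z : ℂ => (1 : ℂ) - Complex.exp (Complex.I * s * z)) (|s| / r * ((1 + R / δ) * (Real.exp 1 * τ / t)))
      (by fun_prop) (by positivity) ?_ x).trans ?_)
    · intro ξ η hη
      refine (mult_bound s ξ η _ hη).trans ?_
      set l := 1 / (4 * δ) * Real.log (Real.exp 1 * τ / t) with hl
      have hl0 : 0 ≤ l := by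
        have := Real.log_nonneg hq
        positivity
      have e4 : Real.exp (4 * δ * l) = Real.exp 1 * τ / t := by
        rw [hl]
        rw [show 4 * δ * (1 / (4 * δ) * Real.log (Real.exp 1 * τ / t)) = Real.log (Real.exp 1 * τ / t) by field_simp]
        exact Real.exp_log (by linarith)
      have hδl : 0 ≤ δ * l := by positivity
      have e1 : 1 + r * l ≤ (1 + R / δ) * Real.exp (δ * l) := by
        have h1 := Real.add_one_le_exp (δ * l)
        calc 1 + r * l ≤ 1 + R * l := by gcongr
          _ ≤ (1 + R / δ) * (1 + δ * l) := by
            have e : (1 + R / δ) * (1 + δ * l) = 1 + R * l + δ * l + R / δ := by field_simp; ring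
            rw [e]
            have : 0 ≤ R / δ := by positivity
            linarith
          _ ≤ _ := by gcongr; linarith
      have e2 : Real.exp (|s| * l) ≤ Real.exp (δ * l) := by gcongr
      calc |s| * (|ξ| + l) * Real.exp (|s| * l) ≤ |s| * (|ξ| + l) * Real.exp (δ * l) := by gcongr
        _ = |s| / r * (r * |ξ| + r * l) * Real.exp (δ * l) := by field_simp
        _ ≤ |s| / r * ((1 + r * |ξ|) * (1 + r * l)) * Real.exp (δ * l) := by
          gcongr
          have h1 : 0 ≤ r * |ξ| := by positivity
          have h2 : 0 ≤ r * l := by positivity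
          nlinarith
        _ ≤ |s| / r * ((1 + r * |ξ|) * ((1 + R / δ) * Real.exp (δ * l))) * Real.exp (δ * l) := by
          gcongr
        _ = |s| / r * (1 + R / δ) * (1 + r * |ξ|) * Real.exp (δ * l + δ * l) := by
          rw [Real.exp_add]; ring
        _ ≤ |s| / r * (1 + R / δ) * (1 + r * |ξ|) * Real.exp (4 * δ * l) := by
          gcongr; linarith
        _ = _ := by rw [e4]; ring
    · apply le_of_eq; ring
end HV

namespace HV

lemma Q_le_tg {ν m h hinv : ℝ → ℝ} {α C₁ τ δ : ℝ} (V : HV ν m h hinv α C₁ τ δ) (ε p : ℝ)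
    {t : ℝ} (ht : 0 < t) (x y : ℝ) (hx : |x / 2| < ε) (hxy : |x - y| ≤ hinv (1 / t) / 4) :
    Qf h t (hinv (1 / t)) y ≤ tg h hinv τ ε p t (x / 2) := by
  have hr := V.r_pos ht
  have hhr := V.h_r ht
  set r := hinv (1 / t) with hrd
  have hM : 0 < max |y| r := lt_of_lt_of_le hr (le_max_right _ _)
  have hle : Qf h t r y ≤ 1 / r := by
    unfold Qf
    have h1 : h (max |y| r) ≤ h r := V.h_mono hr (le_max_right _ _)
    calc t * h (max |y| r) / max |y| r ≤ t * h r / r := by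
          have := V.h_nonneg r hr
          gcongr
          exact le_max_right _ _
      _ = 1 / r := by rw [hhr]; field_simp
  unfold tg
  split_ifs with h0
  · exact hle
  · refine le_min hle ?_
    have hxp : 0 < |x / 2| := abs_pos.2 h0
    have hxM : |x / 2| ≤ max |y| r := by
      have h1 : |x| ≤ |x - y| + |y| := by
        have := abs_add_le (x - y) y
        simpa using this
      rw [abs_div, abs_two]
      have h2 := le_max_left |y| r
      have h3 := le_max_right |y| r
      linarith
    unfold Qf
    have h1 : h (max |y| r) ≤ h |x / 2| := V.h_mono hxp hxM
    have := V.h_nonneg _ hxp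
    gcongr

lemma far_le_tg {ν m h hinv : ℝ → ℝ} {α C₁ τ δ : ℝ} (V : HV ν m h hinv α C₁ τ δ) (ε p : ℝ)
    (hε : 0 < ε) (hδ24 : δ ≤ 1 / 24) (hδε : δ ≤ ε / 2)
    (hp : p + 1 + 1 / α ≤ 3 * ε / (16 * δ)) :
    ∃ C : ℝ, 0 < C ∧ ∀ t : ℝ, 0 < t → t ≤ τ → ∀ x y : ℝ, ε ≤ |x / 2| → |x - y| ≤ δ →
      1 / hinv (1 / t) * ((Real.exp 1 * τ / t) * (t / (Real.exp 1 * τ)) ^ (|y| / (4 * δ))) ≤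
        C * tg h hinv τ ε p t (x / 2) := by
  obtain ⟨B, hB, hr⟩ := V.r_lower
  have hτ := V.hτ
  have hδ := V.hδ
  have hα := V.hα
  set c0 := min (1 / hinv (1 / τ)) (τ * h ε / ε) * Real.exp ε / τ ^ p with hc0
  have hc0p : 0 < c0 := by
    have h1 := V.r_pos hτ
    have h2 := V.h_pos ε hε
    have h3 : 0 < min (1 / hinv (1 / τ)) (τ * h ε / ε) := lt_min (by positivity) (by positivity)
    positivity
  have he1 := Real.exp_pos 1
  refine ⟨B / (Real.exp 1 * τ) ^ p / c0, by positivity, fun t ht htτ x y hx hxy => ?_⟩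
  have hx0 : x / 2 ≠ 0 := by
    intro h0; rw [h0, abs_zero] at hx; linarith
  have hT : tg h hinv τ ε p t (x / 2) = c0 * (t ^ p * Real.exp (-|x / 2|)) := by
    unfold tg
    rw [if_neg hx0, if_neg (not_lt.2 hx)]
  rw [hT]
  have e0 : B / (Real.exp 1 * τ) ^ p / c0 * (c0 * (t ^ p * Real.exp (-|x / 2|))) =
      B * ((t ^ p / (Real.exp 1 * τ) ^ p) * Real.exp (-|x / 2|)) := by
    field_simp
  rw [e0, ← Real.div_rpow ht.le (by positivity)]
  have hinvq : Real.exp 1 * τ / t = (t / (Real.exp 1 * τ))⁻¹ := by rw [inv_div]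
  have hq0 : 0 < t / (Real.exp 1 * τ) := by positivity
  have hqe : t / (Real.exp 1 * τ) ≤ Real.exp (-1) := by
    rw [Real.exp_neg, div_le_iff₀ (by positivity)]
    rw [← mul_assoc, inv_mul_cancel₀ he1.ne', one_mul]; exact htτ
  have hτt : τ / t ≤ (t / (Real.exp 1 * τ))⁻¹ := by
    rw [inv_div]
    have := Real.one_le_exp (show (0:ℝ) ≤ 1 by norm_num)
    gcongr
    exact le_mul_of_one_le_left hτ.le this
  rw [hinvq]
  set q := t / (Real.exp 1 * τ) with hq
  have hq1 : q ≤ 1 := hqe.trans (by rw [Real.exp_le_one_iff]; norm_num)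
  have hx2 : |x / 2| = |x| / 2 := by rw [abs_div, abs_two]
  have hy : 3 / 4 * |x| ≤ |y| := by
    have h1 : |x| ≤ |x - y| + |y| := by
      have := abs_add_le (x - y) y
      simpa using this
    linarith
  have hu1 : 3 * ε / (16 * δ) ≤ |y| / (8 * δ) := by
    rw [div_le_div_iff₀ (by positivity) (by positivity)]
    have : 3 / 2 * ε ≤ |y| := by linarith
    nlinarith
  have hu2 : |x / 2| ≤ |y| / (8 * δ) := by
    rw [le_div_iff₀ (by positivity)]
    have := abs_nonneg x
    rw [hx2]
    nlinarith
  have hexp : p + |y| / (8 * δ) ≤ |y| / (4 * δ) + (-1) + (-(1 / α)) := by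
    have : |y| / (4 * δ) = |y| / (8 * δ) + |y| / (8 * δ) := by field_simp; ring
    rw [this]; linarith
  calc 1 / hinv (1 / t) * (q⁻¹ * q ^ (|y| / (4 * δ)))
      ≤ (B * (q⁻¹) ^ (1 / α)) * (q⁻¹ * q ^ (|y| / (4 * δ))) := by
        gcongr
        refine (hr t ht htτ).trans ?_
        gcongr
    _ = B * q ^ (|y| / (4 * δ) + (-1) + (-(1 / α))) := by
        rw [Real.rpow_add hq0, Real.rpow_add hq0, Real.rpow_neg_one, Real.inv_rpow hq0.le, Real.rpow_neg hq0.le]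
        ring
    _ ≤ B * q ^ (p + |y| / (8 * δ)) := by
        gcongr B * ?_
        exact Real.rpow_le_rpow_of_exponent_ge hq0 hq1 hexp
    _ = B * (q ^ p * q ^ (|y| / (8 * δ))) := by rw [Real.rpow_add hq0]
    _ ≤ B * (q ^ p * Real.exp (-|x / 2|)) := by
        gcongr
        calc q ^ (|y| / (8 * δ)) ≤ (Real.exp (-1)) ^ (|y| / (8 * δ)) := by
              gcongr
          _ = Real.exp (-(|y| / (8 * δ))) := by rw [← Real.exp_mul]; congr 1; ring
          _ ≤ _ := by gcongr

lemma tg_nonneg {ν m h hinv : ℝ → ℝ} {α C₁ τ δ : ℝ} (V : HV ν m h hinv α C₁ τ δ) (ε p : ℝ) (hε : 0 < ε)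
    {t : ℝ} (ht : 0 < t) (x : ℝ) : 0 ≤ tg h hinv τ ε p t x := by
  have hτ := V.hτ
  have h1 := V.r_pos hτ
  have h2 := V.h_pos ε hε
  have h3 : 0 < min (1 / hinv (1 / τ)) (τ * h ε / ε) := lt_min (by positivity) (by positivity)
  have hr := V.r_pos ht
  unfold tg
  split_ifs with h0
  · positivity
  · have := V.h_pos _ (abs_pos.2 h0)
    exact le_min (by positivity) (by positivity)
  · positivity

lemma oneD {ν m h hinv : ℝ → ℝ} {α C₁ τ δ : ℝ} (V : HV ν m h hinv α C₁ τ δ) (ε p : ℝ)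
    (hε : 0 < ε) (hδ24 : δ ≤ 1 / 24) (hδε : δ ≤ ε / 2)
    (hp : p + 1 + 1 / α ≤ 3 * ε / (16 * δ)) :
    ∃ K : ℝ, 0 < K ∧ ∀ t : ℝ, 0 < t → t ≤ τ → ∀ x x' : ℝ, |x - x'| ≤ hinv (1 / t) / 4 → |x - x'| ≤ δ →
      |Gk m t x| ≤ K * tg h hinv τ ε p t (x / 2) ∧ |Gk m t x'| ≤ K * tg h hinv τ ε p t (x / 2) ∧
      |Gk m t x - Gk m t x'| ≤ K * tg h hinv τ ε p t (x / 2) * (|x - x'| / hinv (1 / t)) := by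
  obtain ⟨K1, hK1, H1⟩ := V.nearQ
  obtain ⟨K2, hK2, H2⟩ := V.farQ
  obtain ⟨C, hC, H3⟩ := V.far_le_tg ε p hε hδ24 hδε hp
  refine ⟨K1 + K2 * C, by positivity, fun t ht htτ x x' hr hd => ?_⟩
  have hT := V.tg_nonneg ε p hε ht (x / 2)
  have hr0 := V.r_pos ht
  have hδ := V.hδ
  have hs : |x' - x| = |x - x'| := abs_sub_comm _ _
  have hxs : x + (x' - x) = x' := by ring
  by_cases hx : |x / 2| < ε
  · have q1 := V.Q_le_tg ε p ht x x hx (by rw [sub_self, abs_zero]; positivity)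
    have q2 := V.Q_le_tg ε p ht x x' hx hr
    obtain ⟨a1, a2⟩ := H1 t ht htτ x (x' - x) (by rw [hs]; exact hr)
    obtain ⟨a3, -⟩ := H1 t ht htτ x' 0 (by rw [abs_zero]; positivity)
    rw [hxs, hs] at a2
    have key : ∀ Q : ℝ, Q ≤ tg h hinv τ ε p t (x / 2) → K1 * Q ≤ (K1 + K2 * C) * tg h hinv τ ε p t (x / 2) := by
      intro Q hQ
      calc K1 * Q ≤ K1 * tg h hinv τ ε p t (x / 2) := by gcongr
        _ ≤ _ := by
          gcongr
          have : 0 < K2 * C := by positivity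
          linarith
    refine ⟨a1.trans (key _ q1), a3.trans (key _ q2), a2.trans ?_⟩
    exact mul_le_mul_of_nonneg_right (key _ q1) (by positivity)
  · push Not at hx
    have q1 := H3 t ht htτ x x hx (by rw [sub_self, abs_zero]; positivity)
    have q2 := H3 t ht htτ x x' hx hd
    obtain ⟨a1, a2⟩ := H2 t ht htτ x (x' - x) (by rw [hs]; exact hd)
    obtain ⟨a3, -⟩ := H2 t ht htτ x' 0 (by rw [abs_zero]; positivity)
    rw [hxs, hs] at a2
    have key : ∀ Q : ℝ, 1 / hinv (1 / t) * Q ≤ C * tg h hinv τ ε p t (x / 2) →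
        K2 / hinv (1 / t) * Q ≤ (K1 + K2 * C) * tg h hinv τ ε p t (x / 2) := by
      intro Q hQ
      calc K2 / hinv (1 / t) * Q = K2 * (1 / hinv (1 / t) * Q) := by ring
        _ ≤ K2 * (C * tg h hinv τ ε p t (x / 2)) := by gcongr
        _ = (K2 * C) * tg h hinv τ ε p t (x / 2) := by ring
        _ ≤ _ := by
          gcongr
          linarith
    refine ⟨a1.trans (key _ q1), a3.trans (key _ q2), a2.trans ?_⟩
    exact mul_le_mul_of_nonneg_right (key _ q1) (by positivity)
end HV

lemma prod_tele {ι : Type*} (s : Finset ι) (a b T e : ι → ℝ) (hT : ∀ i, 0 ≤ T i)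
    (ha : ∀ i, |a i| ≤ T i) (hb : ∀ i, |b i| ≤ T i) (hab : ∀ i, |a i - b i| ≤ T i * e i) :
    |∏ i ∈ s, a i - ∏ i ∈ s, b i| ≤ (∏ i ∈ s, T i) * ∑ i ∈ s, e i := by
  classical
  induction s using Finset.induction_on with
  | empty => simp
  | insert i s hi ih =>
    rw [Finset.prod_insert hi, Finset.prod_insert hi, Finset.prod_insert hi, Finset.sum_insert hi]
    have hP : |∏ i ∈ s, b i| ≤ ∏ i ∈ s, T i := by
      rw [Finset.abs_prod]
      exact Finset.prod_le_prod (fun _ _ => abs_nonneg _) fun j _ => hb j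
    have hT0 : 0 ≤ ∏ i ∈ s, T i := Finset.prod_nonneg fun j _ => hT j
    have e1 : a i * ∏ i ∈ s, a i - b i * ∏ i ∈ s, b i =
        a i * (∏ i ∈ s, a i - ∏ i ∈ s, b i) + (a i - b i) * ∏ i ∈ s, b i := by ring
    rw [e1]
    calc _ ≤ |a i| * |∏ i ∈ s, a i - ∏ i ∈ s, b i| + |a i - b i| * |∏ i ∈ s, b i| := by
          rw [← abs_mul, ← abs_mul]; exact abs_add_le _ _
      _ ≤ T i * ((∏ i ∈ s, T i) * ∑ i ∈ s, e i) + (T i * e i) * ∏ i ∈ s, T i := by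
          refine add_le_add (mul_le_mul (ha i) ih (abs_nonneg _) (hT i))
            (mul_le_mul (hab i) hP (abs_nonneg _) ((abs_nonneg _).trans (hab i)))
      _ = _ := by ring

lemma mk_HV (ν μ μ' h hinv : ℝ → ℝ) (α C₁ τ δ : ℝ) (hα : 0 < α) (hC₁ : 0 < C₁) (hτ : 0 < τ)
    (hδ : 0 < δ) (hδ24 : δ ≤ 1 / 24)
    (hνmeas : Measurable ν) (hνnonneg : ∀ x : ℝ, 0 ≤ ν x) (hνsymm : ∀ x : ℝ, ν (-x) = ν x)
    (hνint : Integrable (fun x : ℝ => min (x ^ 2) 1 * ν x))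
    (hdef : ∀ r : ℝ, 0 < r → h r = ∫ x : ℝ, min 1 (x ^ 2 / r ^ 2) * ν x)
    (hcont : ContinuousOn h (Set.Ioi 0)) (hanti : StrictAntiOn h (Set.Ioi 0))
    (hinvpos : ∀ s : ℝ, 0 < s → 0 < hinv s) (hinvr : ∀ s : ℝ, 0 < s → h (hinv s) = s)
    (hlsc : ∀ θ : ℝ, 0 < θ → ∀ l : ℝ, 1 ≤ l → C₁ * l ^ α * h (l * θ) ≤ h θ)
    (hμmeas : Measurable μ) (hμeq : ∀ x : ℝ, 0 < x → x ≤ δ → μ x = ν x)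
    (hμbound : ∀ x : ℝ, 0 < x → 0 ≤ μ x ∧ μ x ≤ ν x)
    (hμzero : ∀ x : ℝ, 2 * δ ≤ x → μ x = 0) (hμsymm : ∀ x : ℝ, μ (-x) = μ x)
    (hμ'deriv : ∀ x : ℝ, 0 < x → HasDerivAt μ (μ' x) x)
    (hμ'nonpos : ∀ x : ℝ, 0 < x → μ' x ≤ 0) :
    HV ν (fun x => if x = 0 then 0 else μ x) h hinv α C₁ τ δ := by
  have habs : ∀ x, μ |x| = μ x := fun x => by
    rcases abs_choice x with h | h <;> rw [h]; exact hμsymm x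
  have habsν : ∀ x, ν |x| = ν x := fun x => by
    rcases abs_choice x with h | h <;> rw [h]; exact hνsymm x
  have hmeas : Measurable (fun x => if x = 0 then 0 else μ x) :=
    Measurable.ite (measurableSet_singleton 0) measurable_const hμmeas
  have hint : ∀ r : ℝ, 0 < r → Integrable (fun x : ℝ => min 1 (x ^ 2 / r ^ 2) * ν x) := by
    intro r hr
    refine Integrable.mono' (hνint.const_mul (1 + 1 / r ^ 2)) ?_ (ae_of_all _ fun x => ?_)
    · exact ((by fun_prop : Measurable fun x : ℝ => min 1 (x ^ 2 / r ^ 2)).mul hνmeas).aestronglyMeasurable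
    · have h0 := hνnonneg x
      rw [Real.norm_of_nonneg (by positivity), ← mul_assoc]
      gcongr
      rcases le_total (x ^ 2) 1 with h | h
      · rw [min_eq_left h]
        refine (min_le_right _ _).trans ?_
        have : (1 + 1 / r ^ 2) * x ^ 2 = x ^ 2 + x ^ 2 / r ^ 2 := by ring
        rw [this]
        nlinarith [sq_nonneg x]
      · rw [min_eq_right h]
        refine (min_le_left _ _).trans ?_
        have : 0 ≤ 1 / r ^ 2 := by positivity
        linarith
  have hant : AntitoneOn μ (Set.Ioi 0) := by
    refine antitoneOn_of_deriv_nonpos (convex_Ioi 0)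
      (fun x hx => (hμ'deriv x hx).continuousAt.continuousWithinAt) ?_ ?_
    · intro x hx
      rw [interior_Ioi] at hx
      exact (hμ'deriv x hx).differentiableAt.differentiableWithinAt
    · intro x hx
      rw [interior_Ioi] at hx
      rw [(hμ'deriv x hx).deriv]; exact hμ'nonpos x hx
  have hle : ∀ y : ℝ, 0 < y → μ y ≤ 8 * h y / y := by
    intro y hy
    have h4 : h (y / 2) ≤ 4 * h y := by
      rw [hdef (y / 2) (by positivity), hdef y hy, ← integral_const_mul]
      refine integral_mono (hint _ (by positivity)) ((hint y hy).const_mul 4) fun x => ?_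
      have h0 := hνnonneg x
      simp only
      rw [← mul_assoc]
      gcongr
      have : x ^ 2 / (y / 2) ^ 2 = 4 * (x ^ 2 / y ^ 2) := by field_simp; norm_num
      rw [this]
      rcases le_total 1 (x ^ 2 / y ^ 2) with h | h
      · rw [min_eq_left h]
        exact (min_le_left _ _).trans (by norm_num)
      · rw [min_eq_right h]; exact min_le_right _ _
    have h1 : μ y * (y / 2) ≤ h (y / 2) := by
      have e : μ y * (y / 2) = ∫ x : ℝ, (Set.Icc (y / 2) y).indicator (fun _ => μ y) x := by
        rw [integral_indicator measurableSet_Icc, setIntegral_const, Real.volume_real_Icc_of_le (by linarith)]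
        rw [smul_eq_mul]; ring
      rw [e, hdef (y / 2) (by positivity)]
      refine integral_mono ?_ (hint _ (by positivity)) fun x => ?_
      · rw [integrable_indicator_iff measurableSet_Icc]
        exact integrableOn_const (by simp)
      · have h0 := hνnonneg x
        by_cases hx : x ∈ Set.Icc (y / 2) y
        · rw [Set.indicator_of_mem hx]
          have hx0 : 0 < x := by linarith [hx.1]
          have : 1 ≤ x ^ 2 / (y / 2) ^ 2 := by
            rw [one_le_div (by positivity)]
            exact pow_le_pow_left₀ (by positivity) hx.1 2
          simp only
          rw [min_eq_left this, one_mul]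
          exact (hant hx0 hy hx.2).trans (hμbound x hx0).2
        · rw [Set.indicator_of_notMem hx]
          positivity
    rw [le_div_iff₀ hy]
    linarith
  refine
    { hα := hα, hC₁ := hC₁, hτ := hτ, hδ := hδ, hδ1 := by linarith, νmeas := hνmeas, ν0 := hνnonneg,
      νint := hνint, hdef := hdef, hcont := hcont, hanti := hanti, hinvpos := hinvpos, hinvr := hinvr,
      hlsc := hlsc, mmeas := hmeas, m0 := ?_, mν := ?_, meq := ?_, mz := ?_, meven := ?_, mle := ?_ }
  · intro x
    split_ifs with h0
    · exact le_rfl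
    · rw [← habs]; exact (hμbound _ (abs_pos.2 h0)).1
  · intro x
    split_ifs with h0
    · exact hνnonneg x
    · rw [← habs, ← habsν]; exact (hμbound _ (abs_pos.2 h0)).2
  · intro x h0 hx
    rw [if_neg h0, ← habs, ← habsν]
    exact hμeq _ (abs_pos.2 h0) hx
  · intro x hx
    split_ifs with h0
    · rfl
    · rw [← habs]; exact hμzero _ hx.le
  · intro x
    simp only [neg_eq_zero, hμsymm]
  · intro x h0
    rw [if_neg h0, ← habs]
    exact hle _ (abs_pos.2 h0)

/-- estimate on the difference of products of one-dimensional truncated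
heat kernels, with `δ = min{δ₀, εα/(8(d+β+2)), ε/(dη₁²)}`. -/
theorem stmt_11 (d : ℕ) (hd : 2 ≤ d)
    (ν ν' μ μ' h hinv ψδ : Fin d → ℝ → ℝ) (g : Fin d → ℝ → ℝ → ℝ)
    (α β C₁ C₂ η₁ η₄ τ ε δ0 δ : ℝ)
    (hα : 0 < α) (hαβ : α ≤ β) (hβ : β < 2) (hC₁ : 0 < C₁) (hC₂ : 0 < C₂)
    (hη₁ : 1 ≤ η₁) (hη₄ : 0 < η₄) (hτ : 0 < τ) (hε0 : 0 < ε) (hε1 : ε ≤ 1)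
    (hδ0 : 0 < δ0) (hδ0' : δ0 ≤ 1 / 24)
    (hδdef : δ = min δ0 (min (ε * α / (8 * (d + β + 2))) (ε / (d * η₁ ^ 2))))
    -- each ν i is the density of a symmetric infinite Lévy measure on ℝ
    (hνmeas : ∀ i, Measurable (ν i))
    (hνnonneg : ∀ i, ∀ x : ℝ, 0 ≤ ν i x)
    (hνsymm : ∀ i, ∀ x : ℝ, ν i (-x) = ν i x)
    (hνint : ∀ i, Integrable (fun x : ℝ => min (x ^ 2) 1 * ν i x))
    (hνinf : ∀ i, ¬ Integrable (ν i))
    -- regularity of ν i near 0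
    (hν'deriv : ∀ i, ∀ x ∈ Set.Ioo (0:ℝ) η₄, HasDerivAt (ν i) (ν' i x) x)
    (hν'neg : ∀ i, ∀ x ∈ Set.Ioo (0:ℝ) η₄, ν' i x < 0)
    (hν'dec : ∀ i, ∀ x y : ℝ, 0 < x → x < y → y < η₄ → -ν' i y / y ≤ -ν' i x / x)
    -- h i and its inverse
    (hdef : ∀ i, ∀ r : ℝ, 0 < r → h i r = ∫ x : ℝ, min 1 (x ^ 2 / r ^ 2) * ν i x)
    (hcont : ∀ i, ContinuousOn (h i) (Set.Ioi 0))
    (hanti : ∀ i, StrictAntiOn (h i) (Set.Ioi 0))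
    (hlim0 : ∀ i, Tendsto (h i) (nhdsWithin 0 (Set.Ioi 0)) atTop)
    (hlimtop : ∀ i, Tendsto (h i) atTop (nhds 0))
    (hinvpos : ∀ i, ∀ s : ℝ, 0 < s → 0 < hinv i s)
    (hinvr : ∀ i, ∀ s : ℝ, 0 < s → h i (hinv i s) = s)
    (hinvl : ∀ i, ∀ r : ℝ, 0 < r → hinv i (h i r) = r)
    -- scaling conditions
    (hlsc : ∀ i, ∀ θ : ℝ, 0 < θ → ∀ l : ℝ, 1 ≤ l → C₁ * l ^ α * h i (l * θ) ≤ h i θ)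
    (husc : ∀ i, ∀ θ : ℝ, 0 < θ → θ ≤ 1 → ∀ l : ℝ, 0 < l → l ≤ 1 →
      h i (l * θ) ≤ C₂ * l ^ (-β) * h i θ)
    -- μ i = μ_i^{(δ)} is a symmetric truncation of ν i
    (hμmeas : ∀ i, Measurable (μ i))
    (hμeq : ∀ i, ∀ x : ℝ, 0 < x → x ≤ δ → μ i x = ν i x)
    (hμbound : ∀ i, ∀ x : ℝ, 0 < x → 0 ≤ μ i x ∧ μ i x ≤ ν i x)
    (hμzero : ∀ i, ∀ x : ℝ, 2 * δ ≤ x → μ i x = 0)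
    (hμsymm : ∀ i, ∀ x : ℝ, μ i (-x) = μ i x)
    (hμ'deriv : ∀ i, ∀ x : ℝ, 0 < x → HasDerivAt (μ i) (μ' i x) x)
    (hμ'nonpos : ∀ i, ∀ x : ℝ, 0 < x → μ' i x ≤ 0)
    (hμ'dec : ∀ i, ∀ x y : ℝ, 0 < x → x ≤ y → -μ' i y / y ≤ -μ' i x / x)
    -- ψδ i and the heat kernels g_{i,t}^{(δ)}
    (hψδdef : ∀ i, ∀ ξ : ℝ, ψδ i ξ = ∫ x : ℝ, (1 - Real.cos (ξ * x)) * μ i x)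
    (hgdef : ∀ i, ∀ t : ℝ, 0 < t → ∀ x : ℝ,
      g i t x = (2 * Real.pi)⁻¹ * ∫ ξ : ℝ, Real.cos (x * ξ) * Real.exp (-t * ψδ i ξ)) :
    ∃ c : ℝ, 0 < c ∧ ∀ t : ℝ, 0 < t → t ≤ τ → ∀ x x' : EuclideanSpace ℝ (Fin d),
      (∑ j, |x j - x' j| / hinv j (1 / t)) ≤ 1 / 4 → ‖x - x'‖ ≤ δ →
      |(∏ i, g i t (x i)) - ∏ i, g i t (x' i)| ≤
        c * (∏ i, tg (h i) (hinv i) τ ε ((d + β - 1) / α) t (x i / 2)) *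
          min 1 (∑ j, |x j - x' j| / hinv j (1 / t)) := by
  have hd0 : (2 : ℝ) ≤ d := by exact_mod_cast hd
  have hβ0 : 0 < β := hα.trans_le hαβ
  have hD : 0 < 8 * ((d : ℝ) + β + 2) := by positivity
  have hD2 : 2 ≤ (d : ℝ) * η₁ ^ 2 := by nlinarith
  have hδp : 0 < δ := by
    rw [hδdef]
    refine lt_min hδ0 (lt_min (by positivity) (by positivity))
  have hδ24 : δ ≤ 1 / 24 := by
    rw [hδdef]; exact (min_le_left _ _).trans hδ0'
  have hδa : δ ≤ ε * α / (8 * (d + β + 2)) := by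
    rw [hδdef]; exact (min_le_right _ _).trans (min_le_left _ _)
  have hδε : δ ≤ ε / 2 := by
    have : δ ≤ ε / (d * η₁ ^ 2) := by
      rw [hδdef]; exact (min_le_right _ _).trans (min_le_right _ _)
    exact this.trans (by gcongr)
  have hp : ((d : ℝ) + β - 1) / α + 1 + 1 / α ≤ 3 * ε / (16 * δ) := by
    rw [le_div_iff₀ hD] at hδa
    have e : ((d : ℝ) + β - 1) / α + 1 + 1 / α = (d + β + α) / α := by field_simp; ring
    rw [e, div_le_div_iff₀ hα (by positivity)]
    have : δ * (d + β + α) ≤ δ * (d + β + 2) := by gcongr; linarith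
    nlinarith
  have hV : ∀ i, HV (ν i) (fun x => if x = 0 then 0 else μ i x) (h i) (hinv i) α C₁ τ δ := fun i =>
    mk_HV (ν i) (μ i) (μ' i) (h i) (hinv i) α C₁ τ δ hα hC₁ hτ hδp hδ24 (hνmeas i) (hνnonneg i) (hνsymm i)
      (hνint i) (hdef i) (hcont i) (hanti i) (hinvpos i) (hinvr i) (hlsc i) (hμmeas i) (hμeq i) (hμbound i)
      (hμzero i) (hμsymm i) (hμ'deriv i) (hμ'nonpos i)
  have hψ : ∀ i ξ, ψδ i ξ = psiR (fun x => if x = 0 then 0 else μ i x) ξ := by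
    intro i ξ
    rw [hψδdef]
    unfold psiR
    congr 1; ext x
    by_cases h0 : x = 0
    · simp [h0]
    · simp [h0]
  have hg : ∀ i t, 0 < t → ∀ x, g i t x = Gk (fun x => if x = 0 then 0 else μ i x) t x := by
    intro i t ht x
    rw [hgdef i t ht]
    unfold Gk
    simp only [hψ]
  choose K hK H using fun i => (hV i).oneD ε (((d : ℝ) + β - 1) / α) hε0 hδ24 hδε hp
  refine ⟨∏ i, K i, Finset.prod_pos fun i _ => hK i, fun t ht htτ x x' hsum hnorm => ?_⟩
  have hr : ∀ i, 0 < hinv i (1 / t) := fun i => (hV i).r_pos ht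
  rw [min_eq_right (by linarith), ← Finset.prod_mul_distrib]
  have hc : ∀ i, |x i - x' i| ≤ hinv i (1 / t) / 4 := by
    intro i
    have h1 : |x i - x' i| / hinv i (1 / t) ≤ ∑ j, |x j - x' j| / hinv j (1 / t) :=
      Finset.single_le_sum (f := fun j => |x j - x' j| / hinv j (1 / t))
        (fun j _ => div_nonneg (abs_nonneg _) (hr j).le) (Finset.mem_univ i)
    have h2 := h1.trans hsum
    rw [div_le_iff₀ (hr i)] at h2
    linarith
  have hc2 : ∀ i, |x i - x' i| ≤ δ := by
    intro i
    have h1 := PiLp.norm_apply_le (x - x') i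
    rw [Real.norm_eq_abs] at h1
    exact h1.trans hnorm
  have key := fun i => H i t ht htτ (x i) (x' i) (hc i) (hc2 i)
  refine prod_tele Finset.univ _ _ _ _ (fun i => ?_) (fun i => ?_) (fun i => ?_) (fun i => ?_)
  · exact mul_nonneg (hK i).le ((hV i).tg_nonneg ε _ hε0 ht _)
  · rw [hg i t ht]; exact (key i).1
  · rw [hg i t ht]; exact (key i).2.1
  · rw [hg i t ht, hg i t ht]; exact (key i).2.2
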